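/- Assume d ≥ 3, Ω is irreducible, and the torsion-free group Γ divides Ω. Then no sequence of pairwise distinct boundary flats of Ω converges to a flat of Ω; that is, the set of boundary flats is closed and discrete in the geometric topology. -/

import Mathlib

open Set Filter Metric

noncomputable section

/-- `ℝ^d`. -/
abbrev Euc (d : ℕ) := EuclideanSpace ℝ (Fin d)

/-- A flat of `Ω` with prescribed vertices `v`. -/
def IsFlatWith {d : ℕ} (Ω : Set (Euc d)) (v : Fin d → Euc d) : Prop :=
  AffineIndependent ℝ v ∧
  (∀ j, v j ∈ closure Ω \ Ω) ∧
  intrinsicInterior ℝ (convexHull ℝ (Set.range v)) ⊆ Ω ∧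
  convexHull ℝ (Set.range v) \ intrinsicInterior ℝ (convexHull ℝ (Set.range v)) ⊆ closure Ω \ Ω

/-- A (codimension-one, properly embedded) flat of `Ω`. -/
def IsFlat {d : ℕ} (Ω : Set (Euc d)) (F : Set (Euc d)) : Prop :=
  ∃ v : Fin d → Euc d, IsFlatWith Ω v ∧ F = intrinsicInterior ℝ (convexHull ℝ (Set.range v))

/-- The cone over a subset of `ℝ^d`, inside `ℝ^d × ℝ ≅ ℝ^{d+1}`. -/
def coneOver {d : ℕ} (S : Set (Euc d)) : Set (Euc d × ℝ) :=
  {p | ∃ t : ℝ, 0 < t ∧ ∃ x ∈ S, p = t • (x, (1 : ℝ))}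

/-- Irreducibility of a properly convex domain: its cone admits no direct-sum
decomposition into convex cones. -/
def IsIrreducibleDomain {d : ℕ} (Ω : Set (Euc d)) : Prop :=
  ¬ ∃ (V₁ V₂ : Submodule ℝ (Euc d × ℝ)) (C₁ C₂ : Set (Euc d × ℝ)),
      V₁ ≠ ⊥ ∧ V₂ ≠ ⊥ ∧ V₁ ≠ ⊤ ∧ V₂ ≠ ⊤ ∧ IsCompl V₁ V₂ ∧
      C₁ ⊆ (V₁ : Set (Euc d × ℝ)) ∧ C₂ ⊆ (V₂ : Set (Euc d × ℝ)) ∧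
      Convex ℝ C₁ ∧ Convex ℝ C₂ ∧
      (∀ t : ℝ, 0 < t → ∀ c ∈ C₁, t • c ∈ C₁) ∧
      (∀ t : ℝ, 0 < t → ∀ c ∈ C₂, t • c ∈ C₂) ∧
      coneOver Ω = {p | ∃ c₁ ∈ C₁, ∃ c₂ ∈ C₂, p = c₁ + c₂}

/-- The homeomorphism of `Ω` induced by a linear automorphism of `ℝ^{d+1}`
preserving the cone over `Ω`. -/
def projAct {d : ℕ} (g : (Euc d × ℝ) ≃ₗ[ℝ] (Euc d × ℝ)) (x : Euc d) : Euc d :=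
  ((g (x, 1)).2)⁻¹ • (g (x, 1)).1

/-- `Γ` divides `Ω`: every element preserves the cone over `Ω`; the induced action on `Ω`
is free and properly discontinuous, and admits a compact set whose translates cover `Ω`. -/
def Divides {d : ℕ} (Ω : Set (Euc d))
    (Γ : Subgroup ((Euc d × ℝ) ≃ₗ[ℝ] (Euc d × ℝ))) : Prop :=
  (∀ γ ∈ Γ, (γ : (Euc d × ℝ) ≃ₗ[ℝ] (Euc d × ℝ)) '' coneOver Ω = coneOver Ω) ∧
  (∀ γ ∈ Γ, γ ≠ 1 → ∀ x ∈ Ω, projAct γ x ≠ x) ∧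
  (∀ K : Set (Euc d), K ⊆ Ω → IsCompact K →
    {γ : (Euc d × ℝ) ≃ₗ[ℝ] (Euc d × ℝ) | γ ∈ Γ ∧ (projAct γ '' K ∩ K).Nonempty}.Finite) ∧
  (∃ K : Set (Euc d), K ⊆ Ω ∧ IsCompact K ∧ (⋃ γ ∈ Γ, projAct γ '' K) = Ω)

/-- `Γ` is torsion-free. -/
def TorsionFreeSub {d : ℕ} (Γ : Subgroup ((Euc d × ℝ) ≃ₗ[ℝ] (Euc d × ℝ))) : Prop :=
  ∀ γ ∈ Γ, ∀ n : ℕ, n ≠ 0 → γ ^ n = 1 → γ = 1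

/-- Convergence of a sequence of flats: Hausdorff convergence of their closures. -/
def FlatsConverge {d : ℕ} (Fs : ℕ → Set (Euc d)) (F : Set (Euc d)) : Prop :=
  Tendsto (fun i => hausdorffDist (closure (Fs i)) (closure F)) atTop (nhds 0)

/-- A flat is isolated if no sequence of flats, all distinct from it, converges to it. -/
def IsIsolatedFlat {d : ℕ} (Ω F : Set (Euc d)) : Prop :=
  ¬ ∃ Fs : ℕ → Set (Euc d), (∀ i, IsFlat Ω (Fs i)) ∧ (∀ i, Fs i ≠ F) ∧ FlatsConverge Fs F

/-- The union of all flats of `Ω`. -/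
def flatsUnion {d : ℕ} (Ω : Set (Euc d)) : Set (Euc d) := ⋃₀ {F | IsFlat Ω F}

/-- A boundary flat: a flat contained in the closure of a connected component of the
complement of the union of all flats. -/
def IsBoundaryFlat {d : ℕ} (Ω F : Set (Euc d)) : Prop :=
  IsFlat Ω F ∧ ∃ x ∈ Ω \ flatsUnion Ω,
    F ⊆ closure (connectedComponentIn (Ω \ flatsUnion Ω) x)

/-- A properly convex open cone on which the linear automorphisms act cocompactly. -/
structure IsQuasiHomogeneousCone {V : Type*} [NormedAddCommGroup V] [NormedSpace ℝ V]
    (C : Set V) : Prop where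
  isOpen : IsOpen C
  convex : Convex ℝ C
  smul_mem : ∀ {t : ℝ} {x : V}, 0 < t → x ∈ C → t • x ∈ C
  proper : ∃ M : ℝ, 0 < M ∧ ∀ a ∈ closure C, ∀ b ∈ closure C, ‖a‖ ≤ M * ‖a + b‖
  cocompact : ∃ K ⊆ C, IsCompact K ∧
    ∀ p ∈ C, ∃ g : V ≃L[ℝ] V, (∀ x, g x ∈ C ↔ x ∈ C) ∧ g p ∈ K

/-- A cone is indecomposable if it is not the sum of its images under a pair of complementary
projections, except in the trivial way. -/
def IsIndecomposableCone {V : Type*} [NormedAddCommGroup V] [NormedSpace ℝ V]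
    (C : Set V) : Prop :=
  ∀ π : V →L[ℝ] V, (∀ x, π (π x) = π x) → (∀ x ∈ C, ∀ y ∈ C, π x + (y - π y) ∈ C) →
    π = 0 ∨ π = ContinuousLinearMap.id ℝ V

theorem opNorm_le_of_bounded_on_ball {V W : Type*} [NormedAddCommGroup V] [NormedSpace ℝ V]
    [NormedAddCommGroup W] [NormedSpace ℝ W] (B : V →L[ℝ] W) {r c : ℝ} (hr : 0 < r)
    (h : ∀ v, ‖v‖ < r → ‖B v‖ ≤ c) : ‖B‖ ≤ 2 * c / r := by
  have hc : 0 ≤ c := (norm_nonneg _).trans (h 0 (by simpa using hr))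
  refine ContinuousLinearMap.opNorm_le_bound _ (by positivity) fun v => ?_
  rcases eq_or_ne v 0 with rfl | hv
  · simp
  have hv' : 0 < ‖v‖ := norm_pos_iff.2 hv
  have h1 := h ((r / (2 * ‖v‖)) • v) (by
    rw [norm_smul, Real.norm_of_nonneg (by positivity)]
    field_simp
    norm_num)
  rw [map_smul, norm_smul, Real.norm_of_nonneg (by positivity)] at h1
  calc ‖B v‖ = 2 * ‖v‖ / r * (r / (2 * ‖v‖) * ‖B v‖) := by field_simp
    _ ≤ 2 * ‖v‖ / r * c := by gcongr
    _ = 2 * c / r * ‖v‖ := by ring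

theorem tendsto_apply_of_tendsto {V W α : Type*} [NormedAddCommGroup V] [NormedSpace ℝ V]
    [NormedAddCommGroup W] [NormedSpace ℝ W] {l : Filter α} {f : α → V →L[ℝ] W} {x : α → V}
    {f₀ : V →L[ℝ] W} {x₀ : V} (hf : Tendsto f l (nhds f₀)) (hx : Tendsto x l (nhds x₀)) :
    Tendsto (fun a => f a (x a)) l (nhds (f₀ x₀)) :=
  (isBoundedBilinearMap_apply.continuous.tendsto (f₀, x₀)).comp (hf.prodMk_nhds hx)

section Cone

variable {V : Type*} [NormedAddCommGroup V] [NormedSpace ℝ V] {C : Set V}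

namespace IsQuasiHomogeneousCone

theorem smul_mem_closure (hC : IsQuasiHomogeneousCone C) {t : ℝ} {x : V} (ht : 0 < t)
    (hx : x ∈ closure C) : t • x ∈ closure C :=
  map_mem_closure (continuous_const_smul t) hx fun _ hy => hC.smul_mem ht hy

theorem add_mem_of_mem_closure (hC : IsQuasiHomogeneousCone C) {a b : V} (ha : a ∈ C)
    (hb : b ∈ closure C) : a + b ∈ C := by
  have h := hC.convex.combo_interior_closure_mem_interior (x := a) (y := b) (a := 1 / 2)
    (b := 1 / 2) (by rwa [hC.isOpen.interior_eq]) hb (by norm_num) (by norm_num) (by norm_num)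
  rw [hC.isOpen.interior_eq] at h
  have h2 := hC.smul_mem (t := 2) two_pos h
  rw [smul_add, smul_smul, smul_smul] at h2
  norm_num at h2
  exact h2

theorem add_mem_closure (hC : IsQuasiHomogeneousCone C) {a b : V} (ha : a ∈ closure C)
    (hb : b ∈ closure C) : a + b ∈ closure C :=
  closure_minimal (t := {x | x + b ∈ closure C})
    (fun _ hy => subset_closure (hC.add_mem_of_mem_closure hy hb))
    (isClosed_closure.preimage (continuous_add_const b)) ha

theorem zero_mem_closure (hC : IsQuasiHomogeneousCone C) {a : V} (ha : a ∈ C) :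
    (0 : V) ∈ closure C := by
  have h : Tendsto (fun t : ℝ => t • a) (nhdsWithin 0 (Ioi 0)) (nhds 0) := by
    have : Tendsto (fun t : ℝ => t • a) (nhds 0) (nhds ((0 : ℝ) • a)) :=
      (continuous_id.smul continuous_const).tendsto 0
    rw [zero_smul] at this
    exact this.mono_left nhdsWithin_le_nhds
  refine mem_closure_of_tendsto h ?_
  filter_upwards [self_mem_nhdsWithin] with t ht using hC.smul_mem ht ha

theorem smul_mem_closure' (hC : IsQuasiHomogeneousCone C) {t : ℝ} {x : V} (ht : 0 ≤ t)
    (hx : x ∈ closure C) : t • x ∈ closure C := by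
  rcases ht.eq_or_lt with rfl | ht
  · obtain ⟨a, ha⟩ := closure_nonempty_iff.1 ⟨x, hx⟩
    rw [zero_smul]
    exact hC.zero_mem_closure ha
  · exact hC.smul_mem_closure ht hx

theorem sum_smul_mem_closure (hC : IsQuasiHomogeneousCone C) (hne : C.Nonempty) {ι : Type*}
    (s : Finset ι) {t : ι → ℝ} {x : ι → V} (ht : ∀ i ∈ s, 0 ≤ t i)
    (hx : ∀ i ∈ s, x i ∈ closure C) : ∑ i ∈ s, t i • x i ∈ closure C := by
  obtain ⟨a, ha⟩ := hne
  refine Finset.sum_induction _ (· ∈ closure C) (fun _ _ => hC.add_mem_closure)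
    (hC.zero_mem_closure ha) fun i hi => hC.smul_mem_closure' (ht i hi) (hx i hi)

/-- Linear automorphisms of the cone also preserve its closure. -/
theorem map_mem_closure_of_forall_mem_iff {g : V ≃L[ℝ] V} (hg : ∀ x, g x ∈ C ↔ x ∈ C) {x : V}
    (hx : x ∈ closure C) : g x ∈ closure C :=
  map_mem_closure g.continuous hx fun y hy => (hg y).2 hy

theorem apply_nonneg_of_mem_closure {φ : V →L[ℝ] ℝ} (h : ∀ x ∈ C, 0 ≤ φ x) {x : V}
    (hx : x ∈ closure C) : 0 ≤ φ x :=
  closure_minimal (t := {x | 0 ≤ φ x}) h (isClosed_le continuous_const φ.continuous) hx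

theorem apply_pos (hC : IsQuasiHomogeneousCone C) {φ : V →L[ℝ] ℝ} (h : ∀ x ∈ C, 0 ≤ φ x)
    (hφ : φ ≠ 0) {x : V} (hx : x ∈ C) : 0 < φ x := by
  refine (h x hx).lt_of_ne fun h0 => hφ ?_
  obtain ⟨r, hr, hb⟩ := Metric.isOpen_iff.1 hC.isOpen x hx
  have key : ∀ v, ‖v‖ < r → φ v = 0 := fun v hv => by
    have h1 := h (x + v) (hb (by simpa using hv))
    have h2 := h (x - v) (hb (by simpa using hv))
    rw [map_add] at h1
    rw [map_sub] at h2
    linarith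
  have := opNorm_le_of_bounded_on_ball φ (c := 0) hr fun v hv => by simp [key v hv]
  simpa using this

theorem exists_ball_subset (hC : IsQuasiHomogeneousCone C) {K : Set V} (hK : IsCompact K)
    (hKC : K ⊆ C) : ∃ r > 0, ∀ q ∈ K, ∀ v, ‖v‖ < r → q + v ∈ C := by
  obtain ⟨r, hr, h⟩ := hK.exists_thickening_subset_open hC.isOpen hKC
  refine ⟨r, hr, fun q hq v hv => h ?_⟩
  rw [Metric.mem_thickening_iff]
  exact ⟨q, hq, by simpa using hv⟩

end IsQuasiHomogeneousCone

/-- The map which is the identity on the range of the projection `π` and the homothety of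
ratio `t` on its kernel. -/
def zoom (π : V →L[ℝ] V) (t : ℝ) : V →L[ℝ] V := π + t • (ContinuousLinearMap.id ℝ V - π)

theorem zoom_apply (π : V →L[ℝ] V) (t : ℝ) (x : V) : zoom π t x = π x + t • (x - π x) := rfl

theorem zoom_zoom {π : V →L[ℝ] V} (hπ : ∀ x, π (π x) = π x) (s t : ℝ) (x : V) :
    zoom π s (zoom π t x) = zoom π (s * t) x := by
  simp only [zoom_apply, map_add, map_smul, map_sub, hπ]
  module

theorem continuous_zoom (π : V →L[ℝ] V) (x : V) : Continuous fun t => zoom π t x := by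
  simp only [zoom_apply]
  fun_prop

/-- If the zooms of an indecomposable quasi-homogeneous cone have uniformly bounded geometry,
then the projection defining them is trivial. -/
theorem IsQuasiHomogeneousCone.eq_zero_or_eq_id_of_zoom [FiniteDimensional ℝ V]
    (hC : IsQuasiHomogeneousCone C)
    (hI : IsIndecomposableCone C) {π : V →L[ℝ] V} (hπ : ∀ x, π (π x) = π x) {p : V} {r M : ℝ}
    (hr : 0 < r)
    (hin : ∀ t : ℝ, 0 < t → t ≤ 1 → ∀ v, ‖v‖ < r → zoom π t (p + v) ∈ C)
    (hout : ∀ t : ℝ, 0 < t → t ≤ 1 → ∀ a b, zoom π t a ∈ C → zoom π t b ∈ C →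
      ‖a‖ ≤ M * ‖a + b‖) :
    π = 0 ∨ π = ContinuousLinearMap.id ℝ V := by
  obtain ⟨M', hM', hprop⟩ := hC.proper
  obtain ⟨K, hKC, hK, hcoc⟩ := hC.cocompact
  obtain ⟨ρ, hρ, hball⟩ := hC.exists_ball_subset hK hKC
  obtain ⟨k, hk⟩ := hK.isBounded.exists_norm_le
  set τ : ℕ → ℝ := fun n => 1 / ((n : ℝ) + 1) with hτ
  have hτ0 : ∀ n, 0 < τ n := fun n => Nat.one_div_pos_of_nat
  have hτ1 : ∀ n, τ n ≤ 1 := fun n => by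
    rw [hτ]; simp only; rw [div_le_one (by positivity)]; linarith [(n.cast_nonneg : (0 : ℝ) ≤ n)]
  have hτlim : Tendsto τ atTop (nhds 0) := tendsto_one_div_add_atTop_nhds_zero_nat
  have hp : ∀ n, zoom π (τ n) p ∈ C := fun n => by
    simpa using hin (τ n) (hτ0 n) (hτ1 n) 0 (by simpa using hr)
  choose g hgC hgK using fun n => hcoc _ (hp n)
  set B : ℕ → V →L[ℝ] V := fun n => (g n : V →L[ℝ] V).comp (zoom π (τ n)) with hB
  set A : ℕ → V →L[ℝ] V := fun n =>
    (zoom π (τ n)⁻¹).comp ((g n).symm : V →L[ℝ] V) with hA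
  have hzi : ∀ n x, zoom π (τ n) (zoom π (τ n)⁻¹ x) = x := fun n x => by
    rw [zoom_zoom hπ, mul_inv_cancel₀ (hτ0 n).ne', zoom_apply]
    module
  have hzi' : ∀ n x, zoom π (τ n)⁻¹ (zoom π (τ n) x) = x := fun n x => by
    rw [zoom_zoom hπ, inv_mul_cancel₀ (hτ0 n).ne', zoom_apply]
    module
  have hBA : ∀ n x, B n (A n x) = x := fun n x => by simp [hB, hA, hzi]
  have hAB : ∀ n x, A n (B n x) = x := fun n x => by simp [hB, hA, hzi']
  have hBbd : ∀ n, ‖B n‖ ≤ 2 * (M' * (2 * k) + k) / r := fun n => by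
    refine opNorm_le_of_bounded_on_ball _ hr fun v hv => ?_
    have h1 : B n (p + v) ∈ C := (hgC n _).2 (hin _ (hτ0 n) (hτ1 n) v hv)
    have h2 : B n (p + -v) ∈ C := (hgC n _).2 (hin _ (hτ0 n) (hτ1 n) (-v) (by simpa using hv))
    have h3 := hprop _ (subset_closure h1) _ (subset_closure h2)
    have h4 : B n (p + v) + B n (p + -v) = (2 : ℝ) • B n p := by
      rw [← map_add, ← map_smul]; congr 1; module
    have h5 : ‖B n p‖ ≤ k := hk _ (hgK n)
    rw [h4, norm_smul, Real.norm_of_nonneg zero_le_two] at h3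
    calc ‖B n v‖ = ‖B n (p + v) - B n p‖ := by rw [map_add]; simp
      _ ≤ ‖B n (p + v)‖ + ‖B n p‖ := norm_sub_le _ _
      _ ≤ M' * (2 * ‖B n p‖) + ‖B n p‖ := by gcongr
      _ ≤ _ := by gcongr
  have hAbd : ∀ n, ‖A n‖ ≤ 2 * (M * ‖(2 : ℝ) • p‖ + ‖p‖) / ρ := fun n => by
    refine opNorm_le_of_bounded_on_ball _ hρ fun v hv => ?_
    have hmem : ∀ u, ‖u‖ < ρ → zoom π (τ n) (A n (B n p + u)) ∈ C := fun u hu => by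
      rw [← hgC n]
      change B n (A n _) ∈ C
      rw [hBA]
      exact hball _ (hgK n) u hu
    have h3 := hout _ (hτ0 n) (hτ1 n) _ _ (hmem v hv) (hmem (-v) (by simpa using hv))
    have h4 : A n (B n p + v) + A n (B n p + -v) = (2 : ℝ) • p := by
      rw [← map_add, ← hAB n ((2 : ℝ) • p), map_smul (B n)]; congr 1; module
    rw [h4] at h3
    calc ‖A n v‖ = ‖A n (B n p + v) - p‖ := by rw [map_add, hAB]; simp
      _ ≤ ‖A n (B n p + v)‖ + ‖p‖ := norm_sub_le _ _
      _ ≤ _ := by gcongr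
  have : ProperSpace (V →L[ℝ] V) := FiniteDimensional.proper ℝ _
  obtain ⟨⟨B', A'⟩, -, s, hs, hlim⟩ := tendsto_subseq_of_bounded
    (s := Metric.closedBall (0 : V →L[ℝ] V) (2 * (M' * (2 * k) + k) / r) ×ˢ
      Metric.closedBall (0 : V →L[ℝ] V) (2 * (M * ‖(2 : ℝ) • p‖ + ‖p‖) / ρ))
    (Metric.isBounded_closedBall.prod Metric.isBounded_closedBall)
    (x := fun n => (B n, A n)) fun n => by simp [hBbd n, hAbd n]
  rw [nhds_prod_eq] at hlim
  have hBl : Tendsto (fun n => B (s n)) atTop (nhds B') := hlim.fst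
  have hAl : Tendsto (fun n => A (s n)) atTop (nhds A') := hlim.snd
  have hBx : ∀ x, Tendsto (fun n => B (s n) x) atTop (nhds (B' x)) := fun x =>
    tendsto_apply_of_tendsto hBl tendsto_const_nhds
  have hBA' : ∀ x, B' (A' x) = x := fun x =>
    tendsto_nhds_unique (tendsto_apply_of_tendsto hBl
      (tendsto_apply_of_tendsto hAl (tendsto_const_nhds (x := x)))) (by simp [hBA])
  have hAB' : ∀ x, A' (B' x) = x := fun x =>
    tendsto_nhds_unique (tendsto_apply_of_tendsto hAl
      (tendsto_apply_of_tendsto hBl (tendsto_const_nhds (x := x)))) (by simp [hAB])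
  have hinv : ∀ x, B' x ∈ C → ∀ l : ℝ, 0 < l → B' (zoom π l x) ∈ closure C := by
    intro x hx l hl
    have hev : ∀ᶠ n in atTop, B (s n) x ∈ C := (hBx x).eventually (hC.isOpen.mem_nhds hx)
    obtain ⟨m, hm⟩ := hev.exists
    have hev2 : ∀ᶠ n in atTop, B (s n) (zoom π l x) ∈ C := by
      have hto : Tendsto (fun n => τ (s n) * l) atTop (nhds 0) := by
        simpa using (hτlim.comp hs.tendsto_atTop).mul_const l
      filter_upwards [hto.eventually (gt_mem_nhds (hτ0 (s m)))] with n hn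
      refine (hgC _ _).2 ?_
      change zoom π (τ (s n)) (zoom π l x) ∈ C
      rw [zoom_zoom hπ]
      have hto2 : Tendsto (fun n => τ (s n)) atTop (nhds 0) := hτlim.comp hs.tendsto_atTop
      obtain ⟨j, hj, hj'⟩ := (hev.and (hto2.eventually
        (gt_mem_nhds (mul_pos (hτ0 (s n)) hl)))).exists
      have e1 : zoom π (τ (s m)) x ∈ C := (hgC _ _).1 hm
      have e2 : zoom π (τ (s j)) x ∈ C := (hgC _ _).1 hj
      have hd : 0 < τ (s m) - τ (s j) := by linarith
      have := hC.convex e2 e1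
        (a := (τ (s m) - τ (s n) * l) / (τ (s m) - τ (s j)))
        (b := (τ (s n) * l - τ (s j)) / (τ (s m) - τ (s j)))
        (div_nonneg (by linarith) hd.le) (div_nonneg (by linarith) hd.le)
        (by field_simp; ring)
      convert this using 1
      simp only [zoom_apply]
      match_scalars <;> field_simp <;> ring
    exact mem_closure_of_tendsto (hBx _) hev2
  have hfst : ∀ x, B' x ∈ C → B' (π x) ∈ closure C := by
    intro x hx
    have h1 : Tendsto (fun t => B' (zoom π t x)) (nhdsWithin 0 (Ioi 0)) (nhds (B' (π x))) := by
      have : Continuous fun t => B' (zoom π t x) := B'.continuous.comp (continuous_zoom π x)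
      have h := this.tendsto 0
      simp only [zoom_apply, zero_smul, add_zero] at h
      exact h.mono_left nhdsWithin_le_nhds
    refine isClosed_closure.mem_of_tendsto h1 ?_
    filter_upwards [self_mem_nhdsWithin] with t ht using hinv x hx t ht
  have hsnd : ∀ x, B' x ∈ C → B' (x - π x) ∈ closure C := by
    intro x hx
    have h1 : Tendsto (fun t : ℝ => B' (t • π x + (x - π x))) (nhdsWithin 0 (Ioi 0))
        (nhds (B' (x - π x))) := by
      have : Continuous fun t : ℝ => B' (t • π x + (x - π x)) := by fun_prop
      have h := this.tendsto 0
      simp only [zero_smul, zero_add] at h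
      exact h.mono_left nhdsWithin_le_nhds
    refine isClosed_closure.mem_of_tendsto h1 ?_
    filter_upwards [self_mem_nhdsWithin] with t ht
    have ht' : (0 : ℝ) < t := ht
    have h2 := hC.smul_mem_closure ht' (hinv x hx t⁻¹ (inv_pos.2 ht'))
    rw [← map_smul] at h2
    convert h2 using 2
    simp only [zoom_apply]
    match_scalars <;> field_simp
  have hclosed : ∀ x y, B' x ∈ C → B' y ∈ C → B' (π x + (y - π y)) ∈ closure C :=
    fun x y hx hy => by
      rw [map_add]
      exact hC.add_mem_closure (hfst x hx) (hsnd y hy)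
  have hopen : ∀ x y, B' x ∈ C → B' y ∈ C → B' (π x + (y - π y)) ∈ C := by
    intro x y hx hy
    have hcont : Tendsto (fun δ : ℝ => B' (y - δ • x)) (nhdsWithin 0 (Ioi 0)) (nhds (B' y)) := by
      have : Continuous fun δ : ℝ => B' (y - δ • x) := by fun_prop
      have h := this.tendsto 0
      simp only [zero_smul, sub_zero] at h
      exact h.mono_left nhdsWithin_le_nhds
    have hlt : ∀ᶠ δ : ℝ in nhdsWithin 0 (Ioi 0), δ < 1 :=
      nhdsWithin_le_nhds (gt_mem_nhds one_pos)
    obtain ⟨δ, h1, h2, h3⟩ := ((hcont.eventually (hC.isOpen.mem_nhds hy)).and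
      (hlt.and self_mem_nhdsWithin)).exists
    have h3' : (0 : ℝ) < δ := h3
    have hx' : B' ((1 - δ) • x) ∈ C := by
      rw [map_smul]; exact hC.smul_mem (by linarith) hx
    have h4 := hC.add_mem_of_mem_closure (hC.smul_mem h3' hx) (hclosed _ _ hx' h1)
    rw [← map_smul, ← map_add] at h4
    convert h4 using 2
    simp only [map_sub, map_smul]
    module
  have := hI (B'.comp (π.comp A')) (fun x => by simp [hAB', hπ]) fun x hx y hy => by
    have := hopen (A' x) (A' y) (by rwa [hBA']) (by rwa [hBA'])
    simpa [map_add, map_sub, hBA'] using this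
  rcases this with h | h
  · left
    ext x
    have := congrArg A' (DFunLike.congr_fun h (B' x))
    simpa [hAB'] using this
  · right
    ext x
    have := congrArg A' (DFunLike.congr_fun h (B' x))
    simpa [hAB'] using this

end Cone

/-- The vertices `w` of a simplex of codimension one inscribed in the cone `C`, together with a
dual family `φ` of functionals supporting `C` along its facets. -/
structure IsFrame {V : Type*} [NormedAddCommGroup V] [NormedSpace ℝ V] (C : Set V) {ι : Type*}
    [Fintype ι] (w : ι → V) (φ : ι → V →L[ℝ] ℝ) : Prop where
  mem_closure : ∀ i, w i ∈ closure C
  sum_mem : ∑ i, w i ∈ C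
  nonneg : ∀ j, ∀ x ∈ C, 0 ≤ φ j x
  apply_self : ∀ i, φ i (w i) = 1
  apply_ne : ∀ i j, i ≠ j → φ i (w j) = 0

namespace IsFrame

variable {V : Type*} [NormedAddCommGroup V] [NormedSpace ℝ V] {C : Set V}
  {ι : Type*} [Fintype ι] {w : ι → V} {φ : ι → V →L[ℝ] ℝ}

theorem ne_zero (hF : IsFrame C w φ) (i : ι) : φ i ≠ 0 := fun h => by
  simpa [h] using hF.apply_self i

theorem vertex_ne_zero (hF : IsFrame C w φ) (i : ι) : w i ≠ 0 := fun h => by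
  simpa [h] using hF.apply_self i

theorem nonneg_of_mem_closure (hF : IsFrame C w φ) (i : ι) {x : V} (hx : x ∈ closure C) :
    0 ≤ φ i x :=
  IsQuasiHomogeneousCone.apply_nonneg_of_mem_closure (hF.nonneg i) hx

theorem pos (hC : IsQuasiHomogeneousCone C) (hF : IsFrame C w φ) (i : ι) {x : V} (hx : x ∈ C) :
    0 < φ i x :=
  hC.apply_pos (hF.nonneg i) (hF.ne_zero i) hx

theorem apply_sum_smul (hF : IsFrame C w φ) (t : ι → ℝ) (j : ι) :
    φ j (∑ i, t i • w i) = t j := by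
  rw [map_sum, Finset.sum_eq_single j]
  · simp [hF.apply_self]
  · intro i _ hij
    simp [hF.apply_ne j i hij.symm]
  · simp

theorem apply_sum (hF : IsFrame C w φ) (j : ι) : φ j (∑ i, w i) = 1 := by
  simpa using hF.apply_sum_smul (fun _ => 1) j

theorem sum_smul_mem (hC : IsQuasiHomogeneousCone C) (hF : IsFrame C w φ) {t : ι → ℝ}
    (ht : ∀ i, 0 < t i) : ∑ i, t i • w i ∈ C := by
  rcases isEmpty_or_nonempty ι with h | h
  · simpa using hF.sum_mem
  obtain ⟨i₀, hi₀⟩ := Finite.exists_min t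
  have h := hC.add_mem_of_mem_closure (hC.smul_mem (ht i₀) hF.sum_mem)
    (hC.sum_smul_mem_closure ⟨_, hF.sum_mem⟩ Finset.univ (t := fun i => t i - t i₀) (x := w)
      (fun i _ => sub_nonneg.2 (hi₀ i)) fun i _ => hF.mem_closure i)
  rw [Finset.smul_sum, ← Finset.sum_add_distrib] at h
  convert h using 2
  module

theorem rescale (hC : IsQuasiHomogeneousCone C) (hF : IsFrame C w φ) {t : ι → ℝ}
    (ht : ∀ i, 0 < t i) : IsFrame C (fun i => t i • w i) fun i => (t i)⁻¹ • φ i where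
  mem_closure i := hC.smul_mem_closure (ht i) (hF.mem_closure i)
  sum_mem := hF.sum_smul_mem hC ht
  nonneg j x hx := mul_nonneg (inv_pos.2 (ht j)).le (hF.nonneg j x hx)
  apply_self i := by simp [hF.apply_self, (ht i).ne']
  apply_ne i j hij := by simp [hF.apply_ne i j hij]

theorem map (hF : IsFrame C w φ) {g : V ≃L[ℝ] V} (hg : ∀ x, g x ∈ C ↔ x ∈ C) :
    IsFrame C (fun i => g (w i)) fun i => (φ i).comp (g.symm : V →L[ℝ] V) where
  mem_closure i := IsQuasiHomogeneousCone.map_mem_closure_of_forall_mem_iff hg (hF.mem_closure i)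
  sum_mem := by rw [← map_sum]; exact (hg _).2 hF.sum_mem
  nonneg j x hx := hF.nonneg j _ ((hg _).1 (by simpa using hx))
  apply_self i := by simp [hF.apply_self]
  apply_ne i j hij := by simp [hF.apply_ne i j hij]

theorem apply_sub_sum (hF : IsFrame C w φ) (v : V) (j : ι) :
    φ j (v - ∑ i, φ i v • w i) = 0 := by
  rw [map_sub, hF.apply_sum_smul, sub_self]

theorem exists_coordinate [FiniteDimensional ℝ V] (hF : IsFrame C w φ)
    (hcard : Fintype.card ι + 1 = Module.finrank ℝ V) {e : V} (he : e ≠ 0)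
    (hφ : ∀ i, φ i e = 0) :
    ∃ ρ : V →L[ℝ] ℝ, (∀ v, v = ∑ i, φ i v • w i + ρ v • e) ∧ ρ e = 1 ∧ ∀ i, ρ (w i) = 0 := by
  obtain ⟨f, hf⟩ := SeparatingDual.exists_eq_one (R := ℝ) he
  let T : V →ₗ[ℝ] ι → ℝ := LinearMap.pi fun i => (φ i : V →ₗ[ℝ] ℝ)
  have hsurj : Function.Surjective T := fun t => ⟨∑ i, t i • w i, by
    ext j; exact hF.apply_sum_smul t j⟩
  have hker : Module.finrank ℝ (LinearMap.ker T) = 1 := by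
    have h := T.finrank_range_add_finrank_ker
    rw [LinearMap.range_eq_top.2 hsurj, finrank_top, Module.finrank_fintype_fun_eq_card] at h
    omega
  have hemem : e ∈ LinearMap.ker T := by
    rw [LinearMap.mem_ker]; ext i; exact hφ i
  have hspan : ∀ v, (∀ i, φ i v = 0) → v = f v • e := fun v hv => by
    obtain ⟨c, hc⟩ := (finrank_eq_one_iff_of_nonzero' (⟨e, hemem⟩ : LinearMap.ker T)
      (fun h => he (congrArg Subtype.val h))).1 hker
      ⟨v, by rw [LinearMap.mem_ker]; ext i; exact hv i⟩
    have hc' : c • e = v := congrArg Subtype.val hc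
    rw [← hc', map_smul, hf, smul_eq_mul, mul_one]
  refine ⟨f - ∑ i, f (w i) • φ i, fun v => ?_, ?_, fun j => ?_⟩
  · have h := hspan _ (hF.apply_sub_sum v)
    rw [sub_eq_iff_eq_add'] at h
    convert h using 2
    simp [map_sub, map_sum, mul_comm]
  · simp [hf, hφ]
  · have h := hF.apply_sum_smul (fun i => f (w i))
    simp only [sub_apply, sum_apply, smul_apply, smul_eq_mul]
    rw [Finset.sum_eq_single j, hF.apply_self, mul_one, sub_self]
    · intro i _ hij; rw [hF.apply_ne i j hij, mul_zero]
    · simp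

theorem exists_transversal (φ : ι → V →L[ℝ] ℝ)
    (hcard : Fintype.card ι + 1 = Module.finrank ℝ V) :
    ∃ e : V, e ≠ 0 ∧ ∀ i, φ i e = 0 := by
  let T : V →ₗ[ℝ] ι → ℝ := LinearMap.pi fun i => (φ i : V →ₗ[ℝ] ℝ)
  have hT : ¬ Function.Injective T := fun h => by
    have := LinearMap.finrank_le_finrank_of_injective h
    rw [Module.finrank_fintype_fun_eq_card] at this
    omega
  rw [← LinearMap.ker_eq_bot, Submodule.eq_bot_iff] at hT
  push Not at hT
  obtain ⟨e, he, he0⟩ := hT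
  exact ⟨e, he0, fun i => congrFun (LinearMap.mem_ker.1 he) i⟩

/-- The kernel of a nonzero functional vanishing at the vertices of a frame is their span. -/
theorem eq_sum_of_apply_eq_zero [FiniteDimensional ℝ V] (hF : IsFrame C w φ)
    (hcard : Fintype.card ι + 1 = Module.finrank ℝ V) {σ : V →L[ℝ] ℝ} (hσ : σ ≠ 0)
    (hw : ∀ i, σ (w i) = 0) {v : V} (hv : σ v = 0) : v = ∑ i, φ i v • w i := by
  obtain ⟨e, he, hφe⟩ := exists_transversal φ hcard
  obtain ⟨ρ, hρ, -, -⟩ := hF.exists_coordinate hcard he hφe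
  have key : ∀ x, σ x = ρ x * σ e := fun x => by
    conv_lhs => rw [hρ x]
    simp [hw]
  have hσe : σ e ≠ 0 := fun h => hσ (by ext x; simp [key x, h])
  have h0 : ρ v = 0 := by
    have := key v
    rw [hv] at this
    exact (mul_eq_zero.1 this.symm).resolve_right hσe
  conv_lhs => rw [hρ v]
  simp [h0]

end IsFrame

namespace IsFrame

variable {V : Type*} [NormedAddCommGroup V] [NormedSpace ℝ V] {C : Set V}
  {ι : Type*} [Fintype ι] {w : ι → V} {φ : ι → V →L[ℝ] ℝ} [FiniteDimensional ℝ V]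

/-- In an indecomposable quasi-homogeneous cone, the facets of a frame fill the corresponding faces
of the cone. -/
theorem eq_sum_of_mem_closure (hF : IsFrame C w φ) (hcard : Fintype.card ι + 1 = Module.finrank ℝ V)
    (hC : IsQuasiHomogeneousCone C) (hI : IsIndecomposableCone C) {z : V} (hz : z ∈ closure C)
    {j : ι} (hj : φ j z = 0) : z = ∑ i, φ i z • w i := by
  classical
  by_contra hne
  set e : V := z - ∑ i, φ i z • w i with he
  have he0 : e ≠ 0 := sub_ne_zero.2 hne
  obtain ⟨ρ, hρ, -, -⟩ := hF.exists_coordinate hcard he0 (hF.apply_sub_sum z)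
  set c : V := ∑ i, w i with hc
  have hjc : φ j c = 1 := hF.apply_sum j
  obtain ⟨M, hM, hprop⟩ := hC.proper
  let π : V →L[ℝ] V := ContinuousLinearMap.id ℝ V - (φ j).smulRight c
  have hπ : ∀ v, π v = v - φ j v • c := fun v => rfl
  have hjπ : ∀ v, φ j (π v) = 0 := fun v => by simp [hπ, hjc]
  let χ : ι → ℝ := fun i => if i = j then 0 else 1
  set z' : V := ∑ i, χ i • w i + z with hz'
  have hjz' : φ j z' = 0 := by
    rw [hz', map_add, hF.apply_sum_smul, hj]; simp [χ]
  have hnear : ∀ᶠ v : V in nhds 0, 0 < 1 + φ j v ∧ 0 < 1 + ρ (π v) ∧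
      ∀ i, 0 < 1 + φ i (π v) - ρ (π v) * φ i z := by
    have h1 : Continuous fun v : V => 1 + φ j v := by fun_prop
    have h2 : Continuous fun v : V => 1 + ρ (π v) := by fun_prop
    have h3 : ∀ i, Continuous fun v : V => 1 + φ i (π v) - ρ (π v) * φ i z := fun i => by fun_prop
    refine (h1.tendsto 0 |>.eventually (lt_mem_nhds ?_)).and
      ((h2.tendsto 0 |>.eventually (lt_mem_nhds ?_)).and (Filter.eventually_all.2 fun i =>
        (h3 i).tendsto 0 |>.eventually (lt_mem_nhds ?_))) <;> simp
  obtain ⟨r, hr, hball⟩ := Metric.eventually_nhds_iff.1 hnear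
  have := hC.eq_zero_or_eq_id_of_zoom hI (π := π) (p := z' + c) (r := r) (M := M)
    (fun x => by simp [hπ, hjc]) hr ?_ ?_
  · rcases this with h | h
    · refine he0 ?_
      have := DFunLike.congr_fun h e
      rw [hπ, hF.apply_sub_sum z j] at this
      simpa using this
    · have := DFunLike.congr_fun h c
      rw [hπ, hjc] at this
      have hc0 : c = 0 := by simpa using this.symm
      rw [hc0] at hjc
      simp at hjc
  · intro t ht _ v hv
    obtain ⟨h1, h2, h3⟩ := hball (y := v) (by simpa using hv)
    have hcl : ∑ i, (χ i * (1 + φ i (π v) - ρ (π v) * φ i z)) • w i + (1 + ρ (π v)) • z ∈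
        closure C := by
      refine hC.add_mem_closure (hC.sum_smul_mem_closure ⟨_, hF.sum_mem⟩ _ (fun i _ => ?_)
        fun i _ => hF.mem_closure i) (hC.smul_mem_closure h2 hz)
      by_cases hi : i = j
      · simp [χ, hi]
      · simpa [χ, hi] using (h3 i).le
    have hmem := hC.add_mem_of_mem_closure (hC.smul_mem (mul_pos ht h1) hF.sum_mem) hcl
    convert hmem using 1
    have hexp : π v = ∑ i, (χ i * (φ i (π v) - ρ (π v) * φ i z)) • w i + ρ (π v) • z := by
      have hχ : ∑ i, (χ i * (φ i (π v) - ρ (π v) * φ i z)) • w i =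
          ∑ i, (φ i (π v) - ρ (π v) * φ i z) • w i := by
        refine Finset.sum_congr rfl fun i _ => ?_
        by_cases hi : i = j
        · subst hi; simp [hjπ, hj]
        · simp [χ, hi]
      rw [hχ]
      conv_lhs => rw [hρ (π v)]
      simp only [he, sub_smul, mul_smul, Finset.sum_sub_distrib, smul_sub, Finset.smul_sum]
      abel
    have h4 : π (z' + c + v) = z' + π v := by
      simp only [hπ, map_add, hjz', hjc]; module
    have h5 : ∑ i, (χ i * (1 + φ i (π v) - ρ (π v) * φ i z)) • w i + (1 + ρ (π v)) • z =
        z' + π v := by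
      conv_rhs => rw [hexp, hz']
      simp only [add_sub_assoc, mul_add, mul_one, add_smul, one_smul, Finset.sum_add_distrib]
      abel
    have h6 : v = π v + φ j v • c := by rw [hπ]; abel
    rw [zoom_apply, h4, h5]
    conv_lhs =>
      enter [2, 2, 1, 2]
      rw [h6]
    module
  · intro t ht ht1 a b ha hb
    have key : ∀ x, zoom π t x ∈ C → x ∈ C := fun x hx => by
      have h1 := hF.pos hC j hx
      have h2 : φ j (zoom π t x) = t * φ j x := by
        simp [zoom_apply, hπ, hjc]
      have h3 : 0 < φ j x := by
        rw [h2] at h1; exact pos_of_mul_pos_right h1 ht.le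
      have h4 := hC.add_mem_of_mem_closure hx
        (hC.smul_mem_closure' (mul_nonneg (sub_nonneg.2 ht1) h3.le) (subset_closure hF.sum_mem))
      convert h4 using 1
      simp only [zoom_apply, hπ]
      module
    exact hprop _ (subset_closure (key a ha)) _ (subset_closure (key b hb))

end IsFrame

namespace IsFrame

variable {V : Type*} [NormedAddCommGroup V] [NormedSpace ℝ V] {C : Set V}
  {ι : Type*} [Fintype ι] [FiniteDimensional ℝ V]

/-- Frames whose vertex sums converge inside the cone form a relatively compact family. -/
theorem exists_subseq_tendsto (hC : IsQuasiHomogeneousCone C) {w : ℕ → ι → V}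
    {φ : ℕ → ι → V →L[ℝ] ℝ} (hF : ∀ n, IsFrame C (w n) (φ n)) {q : V} (hq : q ∈ C)
    (hlim : Tendsto (fun n => ∑ i, w n i) atTop (nhds q)) :
    ∃ (ω : ι → V) (ψ : ι → V →L[ℝ] ℝ) (s : ℕ → ℕ), StrictMono s ∧ IsFrame C ω ψ ∧
      ∑ i, ω i = q ∧ (∀ i, Tendsto (fun n => w (s n) i) atTop (nhds (ω i))) ∧
      ∀ i, Tendsto (fun n => φ (s n) i) atTop (nhds (ψ i)) := by
  classical
  obtain ⟨M, hM, hprop⟩ := hC.proper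
  obtain ⟨r, hr, hball⟩ := Metric.isOpen_iff.1 hC.isOpen q hq
  have : ProperSpace V := FiniteDimensional.proper ℝ V
  have : ProperSpace (V →L[ℝ] ℝ) := FiniteDimensional.proper ℝ _
  have hw : ∀ n i, ‖w n i‖ ≤ M * ‖∑ i, w n i‖ := fun n i => by
    rw [← Finset.add_sum_erase _ _ (Finset.mem_univ i)]
    refine hprop _ ((hF n).mem_closure i) _ ?_
    have := hC.sum_smul_mem_closure ⟨q, hq⟩ (Finset.univ.erase i) (t := fun _ => 1) (x := w n)
      (fun _ _ => zero_le_one) fun i _ => (hF n).mem_closure i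
    simpa using this
  have hnear : ∀ᶠ n in atTop, dist (∑ i, w n i) q < r / 2 :=
    hlim.eventually (Metric.ball_mem_nhds q (half_pos hr))
  have hbd : ∀ᶠ n in atTop, (w n, φ n) ∈
      Metric.closedBall (0 : ι → V) (M * (‖q‖ + r)) ×ˢ
      Metric.closedBall (0 : ι → V →L[ℝ] ℝ) (2 * 1 / (r / 2)) := by
    filter_upwards [hnear] with n hn
    refine ⟨?_, ?_⟩
    · rw [mem_closedBall_zero_iff, pi_norm_le_iff_of_nonneg (by positivity)]
      intro i
      refine (hw n i).trans ?_
      gcongr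
      rw [dist_eq_norm] at hn
      linarith [norm_le_norm_add_norm_sub' (∑ i, w n i) q]
    · rw [mem_closedBall_zero_iff, pi_norm_le_iff_of_nonneg (by positivity)]
      refine fun i => opNorm_le_of_bounded_on_ball _ (half_pos hr) fun v hv => ?_
      have hmem : ∀ u : V, ‖u‖ < r / 2 → ∑ i, w n i + u ∈ C := fun u hu => by
        refine hball ?_
        rw [Metric.mem_ball, dist_eq_norm, add_sub_right_comm]
        rw [dist_eq_norm] at hn
        linarith [norm_add_le (∑ i, w n i - q) u]
      have h1 := (hF n).nonneg i _ (hmem v hv)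
      have h2 := (hF n).nonneg i _ (hmem (-v) (by simpa using hv))
      rw [map_add, (hF n).apply_sum] at h1 h2
      rw [map_neg] at h2
      rw [Real.norm_eq_abs, abs_le]
      constructor <;> linarith
  obtain ⟨⟨ω, ψ⟩, -, s, hs, hl⟩ := tendsto_subseq_of_frequently_bounded
    (Metric.isBounded_closedBall.prod Metric.isBounded_closedBall) hbd.frequently
  rw [nhds_prod_eq] at hl
  have hwl : ∀ i, Tendsto (fun n => w (s n) i) atTop (nhds (ω i)) := tendsto_pi_nhds.1 hl.fst
  have hφl : ∀ i, Tendsto (fun n => φ (s n) i) atTop (nhds (ψ i)) := tendsto_pi_nhds.1 hl.snd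
  have hsum : ∑ i, ω i = q := tendsto_nhds_unique (tendsto_finsetSum _ fun i _ => hwl i)
    (hlim.comp hs.tendsto_atTop)
  refine ⟨ω, ψ, s, hs, ⟨fun i => ?_, hsum ▸ hq, fun j x hx => ?_, fun i => ?_, fun i j hij => ?_⟩,
    hsum, hwl, hφl⟩
  · exact isClosed_closure.mem_of_tendsto (hwl i) (.of_forall fun n => (hF _).mem_closure i)
  · exact ge_of_tendsto' (tendsto_apply_of_tendsto (hφl j) (tendsto_const_nhds (x := x)))
      fun n => (hF _).nonneg j x hx
  · exact tendsto_nhds_unique (tendsto_apply_of_tendsto (hφl i) (hwl i))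
      (by simp [fun n => (hF n).apply_self i])
  · exact tendsto_nhds_unique (tendsto_apply_of_tendsto (hφl i) (hwl j))
      (by simp [fun n => (hF n).apply_ne i j hij])

theorem exists_bound_transversal [Nonempty ι] (hcard : Fintype.card ι + 1 = Module.finrank ℝ V)
    (hC : IsQuasiHomogeneousCone C) (hI : IsIndecomposableCone C) {K : Set V} (hK : IsCompact K)
    (hKC : K ⊆ C) : ∃ M : ℝ, 0 < M ∧ ∀ (w : ι → V) (φ : ι → V →L[ℝ] ℝ), IsFrame C w φ →
      ∑ i, w i ∈ K → ∀ e, (∀ j, φ j e = 0) → ∑ i, w i + e ∈ closure C → ‖e‖ ≤ M := by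
  by_contra! hcon
  choose w φ hF hwK e hφe hcl he using fun n : ℕ => hcon (n + 1) n.cast_add_one_pos
  have he0 : ∀ n, 0 < ‖e n‖ := fun n => (n.cast_add_one_pos).trans (he n)
  have : ProperSpace V := FiniteDimensional.proper ℝ V
  obtain ⟨⟨q, ε⟩, ⟨hq, hε⟩, s, hs, hl⟩ := (hK.prod (isCompact_sphere (0 : V) 1)).tendsto_subseq
    (x := fun n => (∑ i, w n i, ‖e n‖⁻¹ • e n)) fun n => ⟨hwK n, by
      simp [norm_smul, inv_mul_cancel₀ (he0 n).ne']⟩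
  rw [nhds_prod_eq] at hl
  obtain ⟨ω, ψ, s', hs', hωψ, -, -, hψ⟩ := exists_subseq_tendsto hC
    (fun n => hF (s n)) (hKC hq) hl.fst
  have hεl : Tendsto (fun n => ‖e (s (s' n))‖⁻¹ • e (s (s' n))) atTop (nhds ε) :=
    hl.snd.comp hs'.tendsto_atTop
  have hto : Tendsto (fun n => ‖e (s (s' n))‖⁻¹) atTop (nhds 0) := by
    have : Tendsto (fun n => ‖e n‖) atTop atTop :=
      tendsto_atTop_mono (fun n => by linarith [he n] : ∀ n : ℕ, (n : ℝ) ≤ ‖e n‖)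
        tendsto_natCast_atTop_atTop
    exact tendsto_inv_atTop_zero.comp (this.comp (hs.tendsto_atTop.comp hs'.tendsto_atTop))
  have hεC : ε ∈ closure C := by
    have h : Tendsto (fun n => ‖e (s (s' n))‖⁻¹ • (∑ i, w (s (s' n)) i + e (s (s' n)))) atTop
        (nhds ((0 : ℝ) • q + ε)) := by
      simp only [smul_add]
      exact (hto.smul (hl.fst.comp hs'.tendsto_atTop)).add hεl
    rw [zero_smul, zero_add] at h
    exact isClosed_closure.mem_of_tendsto h (.of_forall fun n =>
      hC.smul_mem_closure (inv_pos.2 (he0 _)) (hcl _))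
  have hψε : ∀ i, ψ i ε = 0 := fun i =>
    tendsto_nhds_unique (tendsto_apply_of_tendsto (hψ i) hεl) (by simp [hφe])
  have h0 := hωψ.eq_sum_of_mem_closure hcard hC hI hεC (hψε (Classical.arbitrary ι))
  simp only [hψε, zero_smul, Finset.sum_const_zero] at h0
  simp [h0] at hε

/-- The extents of the cone on the two sides of a frame are comparable. -/
theorem exists_ratio [Nonempty ι] (hcard : Fintype.card ι + 1 = Module.finrank ℝ V)
    (hC : IsQuasiHomogeneousCone C) (hI : IsIndecomposableCone C) {w : ι → V}
    {φ : ι → V →L[ℝ] ℝ} (hF : IsFrame C w φ) {e : V} (he : ∀ j, φ j e = 0) :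
    ∃ R : ℝ, 0 < R ∧ ∀ x : ι → ℝ, (∀ i, 0 < x i) → ∀ s : ℝ, 0 < s →
      ∑ i, x i • w i - (R * s) • e ∈ closure C → ∑ i, x i • w i + s • e ∈ C := by
  obtain ⟨K, hKC, hK, hcoc⟩ := hC.cocompact
  obtain ⟨M, hM, hbd⟩ := exists_bound_transversal (ι := ι) hcard hC hI hK hKC
  obtain ⟨r, hr, hball⟩ := hC.exists_ball_subset hK hKC
  refine ⟨M / r + 1, by positivity, fun x hx s hs hmem => ?_⟩
  obtain ⟨g, hg, hgK⟩ := hcoc _ (hF.sum_smul_mem hC hx)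
  have h1 := hbd _ _ ((hF.rescale hC hx).map hg) (by rwa [← map_sum])
    (g (-((M / r + 1) * s) • e)) (fun j => by simp [he]) (by
      rw [← map_sum, ← map_add, neg_smul, ← sub_eq_add_neg]
      exact IsQuasiHomogeneousCone.map_mem_closure_of_forall_mem_iff hg hmem)
  have h2 := hball _ hgK (g (s • e)) (by
    rw [map_smul, norm_smul, norm_neg, norm_mul, Real.norm_of_nonneg hs.le,
      Real.norm_of_nonneg (by positivity)] at h1
    rw [map_smul, norm_smul, Real.norm_of_nonneg hs.le]
    by_contra! h
    have : (M / r + 1) * r ≤ (M / r + 1) * (s * ‖g e‖) := by gcongr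
    rw [add_mul, div_mul_cancel₀ _ hr.ne'] at this
    linarith)
  rwa [← map_add, hg] at h2

end IsFrame

namespace IsFrame

variable {V : Type*} [NormedAddCommGroup V] [NormedSpace ℝ V] {C : Set V}
  {ι : Type*} [Fintype ι] [FiniteDimensional ℝ V] {w : ι → V} {φ : ι → V →L[ℝ] ℝ}

/-- A functional supporting the cone at a vertex of a frame cannot be negative in the direction
transversal to the frame. -/
theorem apply_transversal_nonneg (hF : IsFrame C w φ)
    (hcard : Fintype.card ι + 1 = Module.finrank ℝ V)
    (hC : IsQuasiHomogeneousCone C) (hI : IsIndecomposableCone C) {ψ : V →L[ℝ] ℝ}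
    (hψ : ∀ x ∈ C, 0 ≤ ψ x) {k : ι} (hk : ψ (w k) = 0) {e : V} (he : ∀ j, φ j e = 0) :
    0 ≤ ψ e := by
  by_contra! hneg
  have : Nonempty ι := ⟨k⟩
  have he0 : e ≠ 0 := fun h => by simp [h] at hneg
  obtain ⟨ρ, hρ, -, hρw⟩ := hF.exists_coordinate hcard he0 he
  obtain ⟨R, hR, hratio⟩ := exists_ratio hcard hC hI hF he
  obtain ⟨r, hr, hball⟩ := Metric.isOpen_iff.1 hC.isOpen _ hF.sum_mem
  let π : V →L[ℝ] V := (φ k).smulRight (w k)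
  have hπ : ∀ v, π v = φ k v • w k := fun v => rfl
  have hψw : ∀ i, 0 ≤ ψ (w i) := fun i =>
    IsQuasiHomogeneousCone.apply_nonneg_of_mem_closure hψ (hF.mem_closure i)
  set N : ℝ := (∑ i, ψ (w i)) / -ψ e with hN
  have hN0 : 0 ≤ N := div_nonneg (Finset.sum_nonneg fun i _ => hψw i) (by linarith)
  have := hC.eq_zero_or_eq_id_of_zoom hI (π := π) (p := ∑ i, w i) (r := r)
    (M := (∑ i, ‖w i‖ + (1 + R) * N * ‖e‖) * ‖∑ i, φ i‖) (fun x => by simp [hπ, hF.apply_self])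
    hr ?_ ?_
  · rcases this with h | h
    · have := DFunLike.congr_fun h (w k)
      rw [hπ, hF.apply_self, one_smul] at this
      exact hF.vertex_ne_zero k this
    · have := DFunLike.congr_fun h e
      rw [hπ, he, zero_smul] at this
      exact he0 this.symm
  · intro t ht ht1 v hv
    have hx : ∑ i, w i + v ∈ C := hball (by simpa using hv)
    have := hC.add_mem_of_mem_closure (hC.smul_mem ht hx)
      (hC.smul_mem_closure' (mul_nonneg (sub_nonneg.2 ht1) (hF.nonneg k _ hx)) (hF.mem_closure k))
    convert this using 1
    rw [zoom_apply, hπ]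
    module
  · intro t ht _ a b ha hb
    have hpos : ∀ x, zoom π t x ∈ C → ∀ i, 0 < φ i x := fun x hx i => by
      have h := hF.pos hC i hx
      rcases eq_or_ne i k with rfl | hik
      · simpa [zoom_apply, hπ, hF.apply_self] using h
      · simp only [zoom_apply, hπ, map_add, map_smul, map_sub, hF.apply_ne i k hik, smul_eq_mul,
          mul_zero, sub_zero, zero_add] at h
        exact pos_of_mul_pos_right h ht.le
    set S : ℝ := ∑ i, φ i a with hS
    have hS0 : 0 ≤ S := Finset.sum_nonneg fun i _ => (hpos a ha i).le
    have hle : ∀ i, φ i a ≤ S := fun i =>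
      Finset.single_le_sum (fun i _ => (hpos a ha i).le) (Finset.mem_univ i)
    have hc : ∑ i, φ i a * ψ (w i) ≤ N * S * -ψ e := by
      have h1 : ∑ i, φ i a * ψ (w i) ≤ ∑ i, S * ψ (w i) :=
        Finset.sum_le_sum fun i _ => mul_le_mul_of_nonneg_right (hle i) (hψw i)
      rw [← Finset.mul_sum] at h1
      refine h1.trans_eq ?_
      have : N * -ψ e = ∑ i, ψ (w i) := div_mul_cancel₀ _ (by linarith)
      rw [← this]; ring
    have hψa : ψ a = ∑ i, φ i a * ψ (w i) + ρ a * ψ e := by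
      conv_lhs => rw [hρ a]
      simp
    have hupper : ρ a ≤ N * S := by
      have h := hψ _ ha
      have h2 : ψ (zoom π t a) = t * ψ a := by simp [zoom_apply, hπ, hk]
      have h3 : 0 ≤ ψ a := by rw [h2] at h; exact nonneg_of_mul_nonneg_right h ht
      rw [hψa] at h3
      exact le_of_mul_le_mul_right (by linarith) (neg_pos.2 hneg)
    have hlower : -ρ a ≤ R * (N * S) := by
      by_contra! hcon
      have hρa : ρ a < 0 := by
        have : 0 ≤ R * (N * S) := by positivity
        linarith
      let y : ι → ℝ := fun i => φ i (zoom π t a)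
      have hy : zoom π t a = ∑ i, y i • w i - (R * (t * -ρ a / R)) • e := by
        have hρz : ρ (zoom π t a) = t * ρ a := by
          simp [zoom_apply, hπ, hρw]
        conv_lhs => rw [hρ (zoom π t a), hρz]
        rw [mul_div_cancel₀ _ hR.ne']
        simp only [y]
        module
      have h1 := hratio y (fun i => hF.pos hC i ha) (t * -ρ a / R)
        (div_pos (mul_pos ht (neg_pos.2 hρa)) hR) (hy ▸ subset_closure ha)
      have h2 := hψ _ h1
      have h3 : ψ (∑ i, y i • w i) = t * ∑ i, φ i a * ψ (w i) := by
        rw [map_sum, Finset.mul_sum]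
        refine Finset.sum_congr rfl fun i _ => ?_
        rcases eq_or_ne i k with rfl | hik
        · simp [hk]
        · simp [y, zoom_apply, hπ, hF.apply_ne i k hik, mul_assoc]
      rw [map_add, h3, map_smul, smul_eq_mul] at h2
      have h4 : 0 ≤ t * (N * S * -ψ e - -ρ a / R * -ψ e) := by
        have : t * ∑ i, φ i a * ψ (w i) ≤ t * (N * S * -ψ e) := by gcongr
        calc 0 ≤ _ := h2
          _ ≤ t * (N * S * -ψ e) + t * -ρ a / R * ψ e := by gcongr
          _ = _ := by ring
      have h5 : 0 ≤ (N * S - -ρ a / R) * -ψ e := by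
        rw [sub_mul]; exact nonneg_of_mul_nonneg_right h4 ht
      have h6 : 0 ≤ N * S - -ρ a / R := nonneg_of_mul_nonneg_left h5 (by linarith)
      have h7 : -ρ a / R ≤ N * S := by linarith
      rw [div_le_iff₀ hR] at h7
      linarith
    have habs : |ρ a| ≤ (1 + R) * N * S := by
      have h1 : 0 ≤ R * (N * S) := by positivity
      have h2 : 0 ≤ N * S := by positivity
      rw [abs_le]; constructor <;> linarith
    have hnorm : ‖a‖ ≤ (∑ i, ‖w i‖ + (1 + R) * N * ‖e‖) * S := by
      calc ‖a‖ = ‖∑ i, φ i a • w i + ρ a • e‖ := by rw [← hρ a]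
        _ ≤ ∑ i, ‖φ i a • w i‖ + ‖ρ a • e‖ :=
          (norm_add_le _ _).trans (add_le_add_left (norm_sum_le _ _) _)
        _ ≤ ∑ i, S * ‖w i‖ + (1 + R) * N * S * ‖e‖ := by
          simp only [norm_smul, Real.norm_eq_abs, fun i => abs_of_pos (hpos a ha i)]
          gcongr with i
          exact hle i
        _ = _ := by rw [← Finset.mul_sum]; ring
    have hSab : S ≤ ‖∑ i, φ i‖ * ‖a + b‖ := by
      calc S ≤ ∑ i, φ i (a + b) := Finset.sum_le_sum fun i _ => by
            rw [map_add]; linarith [hpos b hb i]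
        _ = (∑ i, φ i) (a + b) := by simp
        _ ≤ ‖(∑ i, φ i) (a + b)‖ := le_abs_self _
        _ ≤ _ := ContinuousLinearMap.le_opNorm _ _
    calc ‖a‖ ≤ _ := hnorm
      _ ≤ (∑ i, ‖w i‖ + (1 + R) * N * ‖e‖) * (‖∑ i, φ i‖ * ‖a + b‖) := by gcongr
      _ = _ := by ring

theorem apply_transversal_eq_zero (hF : IsFrame C w φ)
    (hcard : Fintype.card ι + 1 = Module.finrank ℝ V)
    (hC : IsQuasiHomogeneousCone C) (hI : IsIndecomposableCone C) {ψ : V →L[ℝ] ℝ}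
    (hψ : ∀ x ∈ C, 0 ≤ ψ x) {k : ι} (hk : ψ (w k) = 0) {e : V} (he : ∀ j, φ j e = 0) :
    ψ e = 0 := by
  have h1 := hF.apply_transversal_nonneg hcard hC hI hψ hk he
  have h2 := hF.apply_transversal_nonneg hcard hC hI hψ hk (e := -e) (by simpa using he)
  rw [map_neg] at h2
  linarith

end IsFrame

namespace IsFrame

variable {V : Type*} [NormedAddCommGroup V] [NormedSpace ℝ V] {C : Set V}
  {ι : Type*} [Fintype ι] [FiniteDimensional ℝ V] {w w' : ι → V} {φ φ' : ι → V →L[ℝ] ℝ}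

/-- If the hyperplane spanned by a frame meets a facet of a second frame in a nonzero point of the
cone, it contains all vertices of this facet. -/
theorem apply_eq_zero_of_mem_facet (hF : IsFrame C w φ) (hF' : IsFrame C w' φ')
    (hcard : Fintype.card ι + 1 = Module.finrank ℝ V)
    (hC : IsQuasiHomogeneousCone C) (hI : IsIndecomposableCone C) {σ : V →L[ℝ] ℝ} (hσ : σ ≠ 0)
    (hw : ∀ i, σ (w i) = 0) {p : V} (hp : p ∈ closure C) (hp0 : p ≠ 0) (hσp : σ p = 0) {z i : ι}
    (hz : φ' z p = 0) (hi : i ≠ z) : σ (w' i) = 0 := by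
  have hpe := hF.eq_sum_of_apply_eq_zero hcard hσ hw hσp
  have hc : ∀ j, 0 ≤ φ' z (w j) := fun j => hF'.nonneg_of_mem_closure z (hF.mem_closure j)
  obtain ⟨k, hk⟩ : ∃ k, φ k p ≠ 0 := by
    by_contra! h
    exact hp0 (by rw [hpe]; simp [h])
  have hkz : φ' z (w k) = 0 := by
    rw [hpe, map_sum, Finset.sum_eq_zero_iff_of_nonneg fun j _ => by
      rw [map_smul]; exact mul_nonneg (hF.nonneg_of_mem_closure j hp) (hc j)] at hz
    have := hz k (Finset.mem_univ k)
    rw [map_smul] at this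
    exact (mul_eq_zero.1 this).resolve_left hk
  obtain ⟨e, he, hφe⟩ := exists_transversal φ hcard
  obtain ⟨ρ, hρ, -, -⟩ := hF.exists_coordinate hcard he hφe
  have hze := hF.apply_transversal_eq_zero hcard hC hI (hF'.nonneg z) hkz hφe
  have hexp : ∀ v, φ' z v = ∑ j, φ j v * φ' z (w j) := fun v => by
    conv_lhs => rw [hρ v]
    simp [hze]
  obtain ⟨j, hj⟩ : ∃ j, φ' z (w j) ≠ 0 := by
    by_contra! h
    exact hF'.ne_zero z (by ext v; simp [hexp v, h])
  have hji : φ j (w' i) = 0 := by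
    have h := hexp (w' i)
    rw [hF'.apply_ne z i hi.symm, eq_comm, Finset.sum_eq_zero_iff_of_nonneg fun l _ =>
      mul_nonneg (hF.nonneg_of_mem_closure l (hF'.mem_closure i)) (hc l)] at h
    exact (mul_eq_zero.1 (h j (Finset.mem_univ j))).resolve_right hj
  rw [hF.eq_sum_of_mem_closure hcard hC hI (hF'.mem_closure i) hji]
  simp [hw]

/-- If the hyperplane spanned by a frame contains a vertex of a second frame, it contains all of
them. -/
theorem apply_eq_zero_of_apply_vertex_eq_zero (hF : IsFrame C w φ) (hF' : IsFrame C w' φ')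
    (hcard : Fintype.card ι + 1 = Module.finrank ℝ V) (h3 : 2 < Fintype.card ι)
    (hC : IsQuasiHomogeneousCone C) (hI : IsIndecomposableCone C) {σ : V →L[ℝ] ℝ} (hσ : σ ≠ 0)
    (hw : ∀ i, σ (w i) = 0) {k : ι} (hk : σ (w' k) = 0) (i : ι) : σ (w' i) = 0 := by
  classical
  obtain ⟨z, hz⟩ : ∃ z, z ∉ ({i, k} : Finset ι) := by
    by_contra! h
    exact absurd ((Finset.card_le_card fun z _ => h z).trans Finset.card_le_two) h3.not_ge
  simp only [Finset.mem_insert, Finset.mem_singleton, not_or] at hz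
  exact hF.apply_eq_zero_of_mem_facet hF' hcard hC hI hσ hw (hF'.mem_closure k)
    (hF'.vertex_ne_zero k) hk (hF'.apply_ne z k hz.2) (Ne.symm hz.1)

/-- The hyperplane spanned by a frame does not separate the vertices of a second frame. -/
theorem apply_nonneg_of_apply_pos (hF : IsFrame C w φ) (hF' : IsFrame C w' φ')
    (hcard : Fintype.card ι + 1 = Module.finrank ℝ V) (h3 : 2 < Fintype.card ι)
    (hC : IsQuasiHomogeneousCone C) (hI : IsIndecomposableCone C) {σ : V →L[ℝ] ℝ} (hσ : σ ≠ 0)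
    (hw : ∀ i, σ (w i) = 0) {i : ι} (hi : 0 < σ (w' i)) (k : ι) : 0 ≤ σ (w' k) := by
  classical
  by_contra! hk
  obtain ⟨z, hz⟩ : ∃ z, z ∉ ({i, k} : Finset ι) := by
    by_contra! h
    exact absurd ((Finset.card_le_card fun z _ => h z).trans Finset.card_le_two) h3.not_ge
  simp only [Finset.mem_insert, Finset.mem_singleton, not_or] at hz
  have hik : i ≠ k := fun h => by rw [h] at hi; exact hi.not_gt hk
  have hp : σ (w' i) • w' k + (-σ (w' k)) • w' i ∈ closure C :=
    hC.add_mem_closure (hC.smul_mem_closure hi (hF'.mem_closure k))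
      (hC.smul_mem_closure (neg_pos.2 hk) (hF'.mem_closure i))
  refine hi.ne' (hF.apply_eq_zero_of_mem_facet hF' hcard hC hI hσ hw hp (fun h => ?_) ?_ ?_
    (Ne.symm hz.1))
  · have := congrArg (φ' k) h
    simp [hF'.apply_self, hF'.apply_ne k i hik.symm, hi.ne'] at this
  · simp [mul_comm]
  · simp [hF'.apply_ne z i hz.1, hF'.apply_ne z k hz.2]

end IsFrame

namespace IsFrame

variable {V : Type*} [NormedAddCommGroup V] [NormedSpace ℝ V] {C : Set V}
  {ι : Type*} [Fintype ι] [FiniteDimensional ℝ V]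

/-- If a second frame crosses the segment from a frame to the boundary of the cone halfway, then the
hyperplane it spans stays away from the vertices of the first frame. -/
theorem exists_pos_le_offset (hcard : Fintype.card ι + 1 = Module.finrank ℝ V)
    (h3 : 2 < Fintype.card ι) (hC : IsQuasiHomogeneousCone C) (hI : IsIndecomposableCone C)
    {K : Set V} (hK : IsCompact K) (hKC : K ⊆ C) (i : ι) :
    ∃ c : ℝ, 0 < c ∧ ∀ (w w' : ι → V) (φ φ' : ι → V →L[ℝ] ℝ) (ε : V) (θ : ℝ),
      IsFrame C w φ → IsFrame C w' φ' → ∑ j, w j ∈ K → (∀ j, φ j ε = 0) →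
      ∑ j, w j + ε ∈ closure C → ∑ j, w j + ε ∉ C → ∑ j, w' j = ∑ j, w j + (1 / 2 : ℝ) • ε →
      0 ≤ θ → w i + θ • ε = ∑ k, φ' k (w i + θ • ε) • w' k → c ≤ θ := by
  have : Nonempty ι := ⟨i⟩
  have : ProperSpace V := FiniteDimensional.proper ℝ V
  by_contra! hcon
  choose w w' φ φ' ε θ hF hF' hwK hφε hcl hnot hsum hθ0 hspan hθ using
    fun n : ℕ => hcon (1 / ((n : ℝ) + 1)) Nat.one_div_pos_of_nat
  obtain ⟨M, -, hM⟩ := exists_bound_transversal (ι := ι) hcard hC hI hK hKC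
  obtain ⟨⟨q, ε'⟩, ⟨hq, -⟩, s, hs, hl⟩ := (hK.prod (isCompact_closedBall (0 : V) M)).tendsto_subseq
    (x := fun n => (∑ j, w n j, ε n)) fun n => ⟨hwK n, by
      simpa using hM _ _ (hF n) (hwK n) _ (hφε n) (hcl n)⟩
  rw [nhds_prod_eq] at hl
  have hql : Tendsto (fun n => ∑ j, w (s n) j) atTop (nhds q) := hl.fst
  have hεl : Tendsto (fun n => ε (s n)) atTop (nhds ε') := hl.snd
  have hqε : q + ε' ∈ closure C :=
    isClosed_closure.mem_of_tendsto (hql.add hεl) (.of_forall fun n => hcl _)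
  have hqε' : q + ε' ∉ C :=
    hC.isOpen.isClosed_compl.mem_of_tendsto (hql.add hεl) (.of_forall fun n => hnot _)
  have hmid : q + (1 / 2 : ℝ) • ε' ∈ C := by
    have := hC.add_mem_of_mem_closure (hC.smul_mem one_half_pos (hKC hq))
      (hC.smul_mem_closure one_half_pos hqε)
    convert this using 1
    module
  obtain ⟨ω, ψ, a, ha, hω, hωq, hωl, hψl⟩ :=
    exists_subseq_tendsto hC (fun n => hF (s n)) (hKC hq) hql
  obtain ⟨ω', ψ', b, hb, hω', hωq', hωl', hψl'⟩ :=
    exists_subseq_tendsto hC (fun n => hF' (s (a n))) hmid (by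
      simp only [hsum]
      exact (hql.add (hεl.const_smul _)).comp ha.tendsto_atTop)
  have hεl2 := hεl.comp ha.tendsto_atTop
  have hθl : Tendsto (fun n => θ (s (a (b n)))) atTop (nhds 0) :=
    (squeeze_zero hθ0 (fun n => (hθ n).le) tendsto_one_div_add_atTop_nhds_zero_nat).comp
      (hs.tendsto_atTop.comp (ha.tendsto_atTop.comp hb.tendsto_atTop))
  have hvl : Tendsto (fun n => w (s (a (b n))) i + θ (s (a (b n))) • ε (s (a (b n)))) atTop
      (nhds (ω i)) := by
    have := ((hωl i).comp hb.tendsto_atTop).add (hθl.smul (hεl2.comp hb.tendsto_atTop))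
    rwa [zero_smul, add_zero] at this
  have hωi : ω i = ∑ k, ψ' k (ω i) • ω' k := by
    refine tendsto_nhds_unique hvl ?_
    have : Tendsto (fun n => ∑ k, φ' (s (a (b n))) k (w (s (a (b n))) i +
        θ (s (a (b n))) • ε (s (a (b n)))) • w' (s (a (b n))) k) atTop
        (nhds (∑ k, ψ' k (ω i) • ω' k)) :=
      tendsto_finsetSum _ fun k _ => (tendsto_apply_of_tendsto (hψl' k) hvl).smul (hωl' k)
    exact this.congr fun n => (hspan _).symm
  have hψε : ∀ j, ψ j ε' = 0 := fun j =>
    tendsto_nhds_unique (tendsto_apply_of_tendsto (hψl j) hεl2) (by simp [hφε])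
  have hε0 : ε' ≠ 0 := fun h => hqε' (by simpa [h] using hKC hq)
  obtain ⟨e, he, hψe⟩ := exists_transversal _ hcard
  obtain ⟨σ, -, hσe, hσ⟩ := hω'.exists_coordinate hcard he hψe
  have hσ0 : σ ≠ 0 := fun h => by simp [h] at hσe
  have hσω := hω'.apply_eq_zero_of_apply_vertex_eq_zero hω hcard h3 hC hI hσ0 hσ (k := i) (by
    rw [hωi]; simp [hσ])
  replace hωq : ∑ i, ω i = q := hωq
  have hσε : σ ε' = 0 := by
    have h := congrArg σ hωq'
    rw [← hωq, map_sum, map_add, map_sum] at h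
    simpa [hσ, hσω] using h
  obtain ⟨ρ, hρ, -, -⟩ := hω.exists_coordinate hcard hε0 hψε
  have := congrArg σ (hρ e)
  simp [hσω, hσε, hσe] at this

end IsFrame

namespace IsFrame

variable {V : Type*} [NormedAddCommGroup V] [NormedSpace ℝ V] {C : Set V}
  {ι : Type*} [Fintype ι] [FiniteDimensional ℝ V]

/-- The offset bound for a second frame crossing, at an interior point `∑ i, x i • w i` of a frame,
the segment to the boundary halfway. -/
theorem exists_pos_le_apply (hcard : Fintype.card ι + 1 = Module.finrank ℝ V)
    (h3 : 2 < Fintype.card ι) (hC : IsQuasiHomogeneousCone C) (hI : IsIndecomposableCone C)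
    (i : ι) :
    ∃ c : ℝ, 0 < c ∧ ∀ (w w' : ι → V) (φ φ' : ι → V →L[ℝ] ℝ) (e : V) (σ : V →L[ℝ] ℝ) (x : ι → ℝ),
      IsFrame C w φ → IsFrame C w' φ' → (∀ j, φ j e = 0) → (∀ k, σ (w' k) = 0) → σ e = -1 →
      (∀ j, 0 < σ (w j)) → (∀ j, 0 < x j) →
      ∑ j, x j • w j + (2 * σ (∑ j, x j • w j)) • e ∈ closure C →
      ∑ j, x j • w j + (2 * σ (∑ j, x j • w j)) • e ∉ C →
      2 * c * σ (∑ j, x j • w j) ≤ x i * σ (w i) := by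
  obtain ⟨K, hKC, hK, hcoc⟩ := hC.cocompact
  obtain ⟨c, hc, hoff⟩ := exists_pos_le_offset (ι := ι) hcard h3 hC hI hK hKC i
  refine ⟨c, hc, fun w w' φ φ' e σ x hF hF' hφe hσw' hσe hσw hx hcl hnot => ?_⟩
  have : Nonempty ι := ⟨i⟩
  have hσ0 : σ ≠ 0 := fun h => by simp [h] at hσe
  set p : V := ∑ j, x j • w j with hp
  have hpC : p ∈ C := hF.sum_smul_mem hC hx
  set m : ℝ := σ p with hm
  have hm0 : 0 < m := by
    rw [hm, hp, map_sum]
    exact Finset.sum_pos (fun j _ => by rw [map_smul]; exact mul_pos (hx j) (hσw j))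
      Finset.univ_nonempty
  set y : V := p + m • e with hy
  have hyC : y ∈ C := by
    have := hC.add_mem_of_mem_closure (hC.smul_mem one_half_pos hpC)
      (hC.smul_mem_closure one_half_pos hcl)
    convert this using 1
    rw [hy]
    module
  have hyw : y = ∑ k, φ' k y • w' k := hF'.eq_sum_of_apply_eq_zero hcard hσ0 hσw' (by
    simp [hy, hσe, ← hm])
  have hy0 : ∀ k, 0 < φ' k y := fun k => hF'.pos hC k hyC
  obtain ⟨g, hg, hgK⟩ := hcoc p hpC
  set u : V := x i • w i + (x i * σ (w i)) • e with hu
  have huw : u = ∑ k, φ' k u • w' k := hF'.eq_sum_of_apply_eq_zero hcard hσ0 hσw' (by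
    simp [hu, hσe])
  have hθ : (x i * σ (w i) / (2 * m)) * (2 * m) = x i * σ (w i) :=
    div_mul_cancel₀ _ (by positivity)
  have hgp : ∑ j, g (x j • w j) = g p := by rw [hp, map_sum]
  have hgu : g (x i • w i) + (x i * σ (w i) / (2 * m)) • g ((2 * m) • e) = g u := by
    rw [hu, map_add, ← map_smul, smul_smul, hθ]
  have := hoff _ _ _ _ (g ((2 * m) • e)) (x i * σ (w i) / (2 * m)) ((hF.rescale hC hx).map hg)
    ((hF'.rescale hC hy0).map hg) (by rwa [hgp]) (fun j => by simp [hφe])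
    (by rw [hgp, ← map_add]; exact IsQuasiHomogeneousCone.map_mem_closure_of_forall_mem_iff hg hcl)
    (by rw [hgp, ← map_add, hg]; exact hnot)
    (by
      rw [hgp, ← map_sum, ← hyw, hy, map_add, ← map_smul g (1 / 2 : ℝ), smul_smul]
      congr 3; ring)
    (div_nonneg (mul_nonneg (hx i).le (hσw i).le) (by positivity))
    (by
      rw [hgu]
      conv_lhs => rw [huw, map_sum]
      refine Finset.sum_congr rfl fun k _ => ?_
      simp only [ContinuousLinearMap.comp_apply, ContinuousLinearEquiv.coe_coe,
        ContinuousLinearEquiv.symm_apply_apply, smul_apply, smul_eq_mul, map_smul, smul_smul]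
      congr 1
      field_simp [(hy0 k).ne'])
  rw [le_div_iff₀ (by positivity)] at this
  linarith

/-- A hyperplane spanned by a frame and disjoint from a given frame stays away from the vertices
of the latter. -/
theorem exists_pos_le_apply_vertex (hcard : Fintype.card ι + 1 = Module.finrank ℝ V)
    (h3 : 2 < Fintype.card ι) (hC : IsQuasiHomogeneousCone C) (hI : IsIndecomposableCone C)
    {w : ι → V} {φ : ι → V →L[ℝ] ℝ} (hF : IsFrame C w φ) {e : V} (he : e ≠ 0)
    (hφe : ∀ j, φ j e = 0) :
    ∃ δ : ℝ, 0 < δ ∧ ∀ (w' : ι → V) (φ' : ι → V →L[ℝ] ℝ) (σ : V →L[ℝ] ℝ), IsFrame C w' φ' →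
      (∀ k, σ (w' k) = 0) → σ e = -1 → (∀ j, 0 < σ (w j)) → ∃ j, δ ≤ σ (w j) := by
  classical
  obtain ⟨i₁, i₂, hi⟩ := Fintype.exists_pair_of_one_lt_card (α := ι) (by omega)
  obtain ⟨c, hc, hbound⟩ := exists_pos_le_apply hcard h3 hC hI i₂
  obtain ⟨h, hh, hhC⟩ : ∃ h : ℝ, 0 < h ∧ ∑ i, w i + h • e ∈ C := by
    have hcont : Tendsto (fun t : ℝ => ∑ i, w i + t • e) (nhdsWithin 0 (Ioi 0))
        (nhds (∑ i, w i)) := by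
      have : Continuous fun t : ℝ => ∑ i, w i + t • e := by fun_prop
      have h := this.tendsto 0
      simp only [zero_smul, add_zero] at h
      exact h.mono_left nhdsWithin_le_nhds
    obtain ⟨t, h1, h2⟩ := ((hcont.eventually (hC.isOpen.mem_nhds hF.sum_mem)).and
      self_mem_nhdsWithin).exists
    exact ⟨t, h2, h1⟩
  have hshort : ∀ s : ℝ, 0 ≤ s → s ≤ h → ∑ i, w i + s • e ∈ C := fun s hs hsh => by
    have := hC.convex hF.sum_mem hhC (a := 1 - s / h) (b := s / h)
      (sub_nonneg.2 ((div_le_one hh).2 hsh)) (by positivity) (by ring)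
    convert this using 1
    have h1 : s / h * h = s := div_mul_cancel₀ _ hh.ne'
    rw [smul_add, smul_smul, h1]
    module
  set N : ℝ := (Fintype.card ι : ℝ) with hN
  have hN0 : 0 < N := by
    rw [hN]; exact_mod_cast (by omega : 0 < Fintype.card ι)
  refine ⟨min (c * h) (h / (2 * N)), lt_min (by positivity) (by positivity),
    fun w' φ' σ hF' hσw' hσe hσw => ?_⟩
  by_contra! hsmall
  let x : ℝ → ι → ℝ := fun τ i => (1 - τ) + if i = i₁ then τ else 0
  have hx : ∀ τ, ∑ i, x τ i • w i = (1 - τ) • ∑ i, w i + τ • w i₁ := fun τ => by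
    simp [x, add_smul, Finset.sum_add_distrib, Finset.smul_sum, ite_smul]
  set m : ℝ → ℝ := fun τ => σ (∑ i, x τ i • w i) with hm
  set q : ℝ → V := fun τ => ∑ i, x τ i • w i + (2 * m τ) • e with hq
  have hqcont : Continuous q := by
    simp only [hq, hm, hx]
    fun_prop
  have hq0 : q 0 ∈ C := by
    have h0 : ∑ i, x 0 i • w i = ∑ i, w i := by simp [hx]
    simp only [hq, hm, h0]
    have hnn : 0 ≤ σ (∑ i, w i) := by
      rw [map_sum]; exact Finset.sum_nonneg fun i _ => (hσw i).le
    refine hshort _ (by positivity) ?_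
    have : ∑ i, σ (w i) ≤ Finset.card (Finset.univ : Finset ι) • (h / (2 * N)) :=
      Finset.sum_le_card_nsmul _ _ _ fun i _ => ((hsmall i).trans_le (min_le_right _ _)).le
    rw [nsmul_eq_mul, Finset.card_univ, ← hN] at this
    rw [map_sum]
    calc 2 * ∑ i, σ (w i) ≤ 2 * (N * (h / (2 * N))) := by gcongr
      _ = h := by field_simp
  have hq1 : q 1 ∉ closure C := fun hmem => by
    have h1 : q 1 = w i₁ + (2 * σ (w i₁)) • e := by simp [hq, hm, hx]
    rw [h1] at hmem
    have h2 := hF.eq_sum_of_mem_closure hcard hC hI hmem (j := i₂) (by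
      simp [hφe, hF.apply_ne i₂ i₁ hi.symm])
    have h3 : ∑ i, φ i (w i₁ + (2 * σ (w i₁)) • e) • w i = w i₁ := by
      rw [Finset.sum_eq_single i₁]
      · simp [hφe, hF.apply_self]
      · intro i _ hne; simp [hφe, hF.apply_ne i i₁ hne]
      · simp
    rw [h3] at h2
    have h4 : (2 * σ (w i₁)) • e = 0 := by simpa using h2
    exact (smul_ne_zero (mul_pos two_pos (hσw i₁)).ne' he) h4
  obtain ⟨τ, hτ, hτC, hτcl⟩ : ∃ τ ∈ Icc (0 : ℝ) 1, q τ ∉ C ∧ q τ ∈ closure C := by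
    by_contra! hcon
    obtain ⟨τ, -, h1, h2⟩ := isPreconnected_Icc (a := (0 : ℝ)) (b := 1) _ _
      (hC.isOpen.preimage hqcont) (isClosed_closure.isOpen_compl.preimage hqcont)
      (fun τ hτ => (em (q τ ∈ C)).imp id (hcon τ hτ)) ⟨0, by simp, hq0⟩ ⟨1, by simp, hq1⟩
    exact h2 (subset_closure h1)
  have hτ1 : 0 < 1 - τ :=
    sub_pos.2 (hτ.2.lt_of_ne fun h => hq1 (h ▸ hτcl))
  have hxpos : ∀ i, 0 < x τ i := fun i => by
    have : 0 ≤ if i = i₁ then τ else 0 := by split_ifs <;> simp [hτ.1]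
    exact add_pos_of_pos_of_nonneg hτ1 this
  have h1 := hbound w w' φ φ' e σ (x τ) hF hF' hφe hσw' hσe hσw hxpos hτcl hτC
  have h2 : (1 - τ) * h < 2 * m τ := by
    by_contra! hle
    refine hτC ?_
    have hm0 : 0 ≤ m τ := by
      simp only [hm, map_sum, map_smul, smul_eq_mul]
      exact Finset.sum_nonneg fun i _ => mul_nonneg (hxpos i).le (hσw i).le
    have h3 := hC.add_mem_of_mem_closure (hC.smul_mem hτ1 (hshort (2 * m τ / (1 - τ))
      (by positivity) (by rw [div_le_iff₀ hτ1]; linarith)))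
      (hC.smul_mem_closure' hτ.1 (hF.mem_closure i₁))
    convert h3 using 1
    rw [smul_add, smul_smul, mul_div_cancel₀ _ hτ1.ne']
    simp only [hq, hx]
    module
  have h4 : x τ i₂ = 1 - τ := by simp [x, hi.symm]
  rw [h4] at h1
  have h5 : σ (w i₂) < c * h := (hsmall i₂).trans_le (min_le_left _ _)
  have h6 : (1 - τ) * σ (w i₂) < (1 - τ) * (c * h) := by gcongr
  have h7 : c * ((1 - τ) * h) < c * (2 * m τ) := by gcongr
  have h8 : 2 * c * m τ ≤ (1 - τ) * σ (w i₂) := h1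
  linarith

end IsFrame

namespace IsFrame

variable {V : Type*} [NormedAddCommGroup V] [NormedSpace ℝ V] {C : Set V}
  {ι : Type*} [Fintype ι]

theorem exists_of_facet_notMem [DecidableEq ι] (hC : IsQuasiHomogeneousCone C) {w : ι → V}
    (hw : ∀ i, w i ∈ closure C) (hsum : ∑ i, w i ∈ C)
    (hfacet : ∀ j, ∑ i ∈ Finset.univ.erase j, w i ∉ C) :
    ∃ φ : ι → V →L[ℝ] ℝ, IsFrame C w φ := by
  have key : ∀ j, ∃ φ : V →L[ℝ] ℝ, (∀ x ∈ C, 0 ≤ φ x) ∧ φ (w j) = 1 ∧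
      ∀ i, j ≠ i → φ (w i) = 0 := fun j => by
    set A : V := ∑ i ∈ Finset.univ.erase j, w i with hA
    have hAcl : A ∈ closure C := by
      simpa only [one_smul] using hC.sum_smul_mem_closure ⟨_, hsum⟩ (Finset.univ.erase j)
        (t := fun _ => 1) (x := w)
        (fun _ _ => zero_le_one) fun i _ => hw i
    obtain ⟨f, hf⟩ := geometric_hahn_banach_open_point hC.convex hC.isOpen (hfacet j)
    have hscale : ∀ x ∈ C, ∀ t : ℝ, 0 < t → t * f x < f A := fun x hx t ht => by
      have h := hf _ (hC.smul_mem ht hx)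
      rwa [map_smul, smul_eq_mul] at h
    have hle : ∀ x ∈ C, f x ≤ 0 := fun x hx => by
      by_contra! hpos
      have h := hscale x hx (|f A| / f x + 1) (by positivity)
      rw [add_mul, div_mul_cancel₀ _ hpos.ne'] at h
      linarith [le_abs_self (f A)]
    have hfA : 0 ≤ f A := by
      by_contra! hneg
      have hx := hf _ hsum
      have h := hscale _ hsum (f A / (2 * f (∑ i, w i)))
        (div_pos_of_neg_of_neg hneg (by linarith))
      have h2 : f A / (2 * f (∑ i, w i)) * f (∑ i, w i) = f A / 2 := by
        have : f (∑ i, w i) ≠ 0 := by linarith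
        field_simp
      rw [h2] at h
      linarith
    have hnn : ∀ x ∈ C, 0 ≤ (-f) x := fun x hx => by simpa using hle x hx
    have hwnn : ∀ i, 0 ≤ (-f) (w i) := fun i =>
      IsQuasiHomogeneousCone.apply_nonneg_of_mem_closure hnn (hw i)
    have hfA0 : (-f) A = 0 :=
      le_antisymm (by simpa using hfA) (IsQuasiHomogeneousCone.apply_nonneg_of_mem_closure hnn hAcl)
    have hzero : ∀ i, j ≠ i → (-f) (w i) = 0 := fun i hij => by
      rw [hA, map_sum, Finset.sum_eq_zero_iff_of_nonneg fun i _ => hwnn i] at hfA0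
      exact hfA0 i (by simp [hij.symm])
    have hpos : 0 < (-f) (w j) := by
      have h1 : (-f) (∑ i, w i) = (-f) (w j) + (-f) A := by
        rw [← map_add, hA, Finset.add_sum_erase _ _ (Finset.mem_univ j)]
      rw [hfA0, add_zero] at h1
      rw [← h1]
      exact hC.apply_pos hnn (fun h => by
        have hx := hf _ hsum
        have := DFunLike.congr_fun h (∑ i, w i)
        have h2 := DFunLike.congr_fun h A
        simp only [neg_apply, zero_apply, neg_eq_zero] at this h2
        linarith) hsum
    refine ⟨((-f) (w j))⁻¹ • -f, fun x hx => ?_, ?_, fun i hij => ?_⟩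
    · exact mul_nonneg (inv_pos.2 hpos).le (hnn x hx)
    · rw [smul_apply, smul_eq_mul, inv_mul_cancel₀ hpos.ne']
    · rw [smul_apply, hzero i hij, smul_zero]
  choose φ h1 h2 h3 using key
  exact ⟨φ, hw, hsum, h1, h2, h3⟩

variable [FiniteDimensional ℝ V] {w : ι → V} {φ : ι → V →L[ℝ] ℝ}

theorem exists_pos_le_abs_apply_vertex (hF : IsFrame C w φ)
    (hcard : Fintype.card ι + 1 = Module.finrank ℝ V)
    (h3 : 2 < Fintype.card ι) (hC : IsQuasiHomogeneousCone C) (hI : IsIndecomposableCone C)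
    {e : V} (he : e ≠ 0) (hφe : ∀ j, φ j e = 0) :
    ∃ δ : ℝ, 0 < δ ∧ ∀ (w' : ι → V) (φ' : ι → V →L[ℝ] ℝ) (σ : V →L[ℝ] ℝ), IsFrame C w' φ' →
      (∀ k, σ (w' k) = 0) → σ e = -1 → (∃ j, σ (w j) ≠ 0) → ∃ j, δ ≤ |σ (w j)| := by
  obtain ⟨δ, hδ, h⟩ := exists_pos_le_apply_vertex hcard h3 hC hI hF he hφe
  obtain ⟨δ', hδ', h'⟩ := exists_pos_le_apply_vertex hcard h3 hC hI hF (neg_ne_zero.2 he)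
    fun j => by rw [map_neg, hφe, neg_zero]
  refine ⟨min δ δ', lt_min hδ hδ', fun w' φ' σ hF' hσw' hσe ⟨k, hk⟩ => ?_⟩
  have hσ0 : σ ≠ 0 := fun h => by simp [h] at hσe
  have hne : ∀ i, σ (w i) ≠ 0 := fun i hi =>
    hk (hF'.apply_eq_zero_of_apply_vertex_eq_zero hF hcard h3 hC hI hσ0 hσw' hi k)
  by_cases hpos : ∃ i, 0 < σ (w i)
  · obtain ⟨i, hi⟩ := hpos
    obtain ⟨j, hj⟩ := h w' φ' σ hF' hσw' hσe fun j =>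
      (hF'.apply_nonneg_of_apply_pos hF hcard h3 hC hI hσ0 hσw' hi j).lt_of_ne (hne j).symm
    exact ⟨j, (min_le_left _ _).trans (hj.trans (le_abs_self _))⟩
  · push Not at hpos
    obtain ⟨j, hj⟩ := h' w' φ' (-σ) hF' (by simpa using hσw') (by simpa using hσe) fun j => by
      simpa using (hpos j).lt_of_ne (hne j)
    exact ⟨j, (min_le_right _ _).trans (hj.trans (neg_le_abs _))⟩

/-- A hyperplane spanned by a frame which passes close to all vertices of a given frame contains
all of them. -/
theorem exists_pos_forall_apply_eq_zero (hF : IsFrame C w φ)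
    (hcard : Fintype.card ι + 1 = Module.finrank ℝ V)
    (h3 : 2 < Fintype.card ι) (hC : IsQuasiHomogeneousCone C) (hI : IsIndecomposableCone C) :
    ∃ η : ℝ, 0 < η ∧ ∀ (w' : ι → V) (φ' : ι → V →L[ℝ] ℝ) (σ : V →L[ℝ] ℝ), IsFrame C w' φ' →
      σ ≠ 0 → (∀ k, σ (w' k) = 0) → ∀ u : ι → V, (∀ i, σ (u i) = 0) → (∀ i, ‖w i - u i‖ ≤ η) →
      ∀ i, σ (w i) = 0 := by
  obtain ⟨e, he, hφe⟩ := exists_transversal φ hcard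
  obtain ⟨ρ, hρ, -, -⟩ := hF.exists_coordinate hcard he hφe
  obtain ⟨δ, hδ, hsep⟩ := hF.exists_pos_le_abs_apply_vertex hcard h3 hC hI he hφe
  set N : ℝ := (Fintype.card ι : ℝ) * (∑ i, ‖φ i‖ + ‖ρ‖) + 1 with hN
  have hN0 : 0 < N := by positivity
  refine ⟨min 1 δ / (4 * N), by positivity, fun w' φ' σ hF' hσ0 hσw' u hu hη => ?_⟩
  set η : ℝ := min 1 δ / (4 * N) with hηdef
  have hη0 : 0 < η := by positivity
  set S : ℝ := ∑ i, |σ (w i)| with hS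
  have hS0 : 0 ≤ S := Finset.sum_nonneg fun i _ => abs_nonneg _
  have hle : ∀ i, |σ (w i)| ≤ S := fun i =>
    Finset.single_le_sum (fun i _ => abs_nonneg (σ (w i))) (Finset.mem_univ i)
  have hbd : ∀ x, |σ x| ≤ (∑ i, ‖φ i‖ + ‖ρ‖) * ‖x‖ * (S + |σ e|) := fun x => by
    calc |σ x| = |∑ i, φ i x * σ (w i) + ρ x * σ e| := by conv_lhs => rw [hρ x]; simp
      _ ≤ ∑ i, |φ i x * σ (w i)| + |ρ x * σ e| :=
        (abs_add_le _ _).trans (add_le_add_left (Finset.abs_sum_le_sum_abs _ _) _)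
      _ ≤ ∑ i, ‖φ i‖ * ‖x‖ * (S + |σ e|) + ‖ρ‖ * ‖x‖ * (S + |σ e|) := by
        simp only [abs_mul]
        gcongr with i
        · exact (φ i).le_opNorm x
        · linarith [hle i, abs_nonneg (σ e)]
        · exact ρ.le_opNorm x
        · linarith
      _ = _ := by rw [← Finset.sum_mul, ← Finset.sum_mul]; ring
  have hSle : S ≤ N * η * (S + |σ e|) := by
    calc S ≤ ∑ _i : ι, (∑ i, ‖φ i‖ + ‖ρ‖) * η * (S + |σ e|) := by
          refine Finset.sum_le_sum fun i _ => ?_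
          have h := hbd (w i - u i)
          rw [map_sub, hu, sub_zero] at h
          refine h.trans ?_
          gcongr
          exact hη i
      _ = (N - 1) * η * (S + |σ e|) := by
        rw [Finset.sum_const, nsmul_eq_mul, Finset.card_univ, hN]; ring
      _ ≤ _ := by gcongr; linarith
  have hNη : N * η = min 1 δ / 4 := by rw [hηdef]; field_simp
  rw [hNη] at hSle
  have hm1 := min_le_left 1 δ
  have hm2 := min_le_right 1 δ
  have hm0 : 0 < min 1 δ := lt_min one_pos hδ
  have hS2 : S ≤ min 1 δ / 2 * |σ e| := by
    have : min 1 δ / 4 * S ≤ 1 / 4 * S := by gcongr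
    nlinarith [mul_nonneg hm0.le (abs_nonneg (σ e))]
  have hσe : σ e ≠ 0 := fun h => hσ0 (by
    have hS' : S = 0 := le_antisymm (by simpa [h] using hS2) hS0
    ext x
    have := hbd x
    rw [hS', h, abs_zero, add_zero, mul_zero] at this
    exact abs_nonpos_iff.1 this)
  by_contra! hne
  obtain ⟨k, hk⟩ := hne
  obtain ⟨j, hj⟩ := hsep w' φ' (-(σ e)⁻¹ • σ) hF' (fun k => by simp [hσw'])
    (by simp [hσe]) ⟨k, by simp [hσe, hk]⟩
  rw [smul_apply, smul_eq_mul, abs_mul, abs_neg, abs_inv] at hj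
  have h1 : |σ (w j)| ≤ δ / 2 * |σ e| := (hle j).trans (hS2.trans (by gcongr))
  have hpos : 0 < |σ e| := abs_pos.2 hσe
  have h2 : |σ e|⁻¹ * |σ (w j)| ≤ |σ e|⁻¹ * (δ / 2 * |σ e|) := by gcongr
  have h4 : |σ e|⁻¹ * (δ / 2 * |σ e|) = δ / 2 := by field_simp
  linarith

end IsFrame

section ConeOver

variable {d : ℕ} {Ω : Set (Euc d)}

theorem mem_coneOver {p : Euc d × ℝ} : p ∈ coneOver Ω ↔ 0 < p.2 ∧ p.2⁻¹ • p.1 ∈ Ω := by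
  constructor
  · rintro ⟨t, ht, x, hx, rfl⟩
    simp [ht, hx, smul_smul, inv_mul_cancel₀ ht.ne']
  · rintro ⟨h1, h2⟩
    refine ⟨p.2, h1, _, h2, ?_⟩
    ext1 <;> simp [smul_smul, mul_inv_cancel₀ h1.ne']

theorem mk_one_mem_coneOver {x : Euc d} : (x, (1 : ℝ)) ∈ coneOver Ω ↔ x ∈ Ω := by
  simp [mem_coneOver]

theorem mk_one_mem_closure_coneOver {x : Euc d} (hx : x ∈ closure Ω) :
    (x, (1 : ℝ)) ∈ closure (coneOver Ω) :=
  map_mem_closure (f := fun x : Euc d => (x, (1 : ℝ))) (by fun_prop) hx fun _ h =>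
    mk_one_mem_coneOver.2 h

/-- The cone over a divisible domain is quasi-homogeneous. -/
theorem isQuasiHomogeneousCone_coneOver (hbd : Bornology.IsBounded Ω) (hop : IsOpen Ω)
    (hconv : Convex ℝ Ω) {Γ : Subgroup ((Euc d × ℝ) ≃ₗ[ℝ] (Euc d × ℝ))} (hdiv : Divides Ω Γ) :
    IsQuasiHomogeneousCone (coneOver Ω) where
  isOpen := by
    have h : coneOver Ω = {p : Euc d × ℝ | 0 < p.2} ∩ (fun p => p.2⁻¹ • p.1) ⁻¹' Ω := by
      ext p; exact mem_coneOver
    rw [h]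
    refine ContinuousOn.isOpen_inter_preimage ?_ (isOpen_lt continuous_const continuous_snd) hop
    exact (continuousOn_snd.inv₀ fun p hp => ne_of_gt hp).smul continuousOn_fst
  convex := by
    rintro _ ⟨t, ht, x, hx, rfl⟩ _ ⟨u, hu, y, hy, rfl⟩ a b ha hb hab
    have hs : 0 < a * t + b * u := by
      rcases ha.eq_or_lt with rfl | ha
      · rw [zero_add] at hab; rw [hab]; linarith
      · have := mul_pos ha ht
        have := mul_nonneg hb hu.le
        linarith
    refine ⟨a * t + b * u, hs, _, hconv hx hy (a := a * t / (a * t + b * u))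
      (b := b * u / (a * t + b * u)) (by positivity) (by positivity) (by field_simp), ?_⟩
    ext1
    · simp [smul_smul, mul_div_cancel₀ _ hs.ne']
    · simp
  smul_mem := by
    rintro t _ ht ⟨u, hu, x, hx, rfl⟩
    exact ⟨t * u, mul_pos ht hu, x, hx, smul_smul _ _ _⟩
  proper := by
    obtain ⟨R, hR0, hR⟩ := hbd.exists_pos_norm_le
    have key : closure (coneOver Ω) ⊆ {p : Euc d × ℝ | ‖p.1‖ ≤ R * p.2 ∧ 0 ≤ p.2} := by
      have hcl : IsClosed {p : Euc d × ℝ | ‖p.1‖ ≤ R * p.2 ∧ 0 ≤ p.2} :=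
        (isClosed_le continuous_fst.norm (continuous_const.mul continuous_snd)).inter
          (isClosed_le continuous_const continuous_snd)
      refine closure_minimal ?_ hcl
      rintro _ ⟨t, ht, x, hx, rfl⟩
      refine ⟨?_, by simpa using ht.le⟩
      simp only [Prod.smul_mk, smul_eq_mul, mul_one, norm_smul, Real.norm_of_nonneg ht.le]
      rw [mul_comm]
      gcongr
      exact hR x hx
    refine ⟨R + 1, by linarith, fun a ha b hb => ?_⟩
    obtain ⟨ha1, ha2⟩ := key ha
    obtain ⟨hb1, hb2⟩ := key hb
    have h1 : ‖a‖ ≤ (R + 1) * a.2 := by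
      rw [Prod.norm_def, Real.norm_of_nonneg ha2]
      refine max_le ?_ ?_ <;> nlinarith
    have h2 : a.2 ≤ ‖a + b‖ := by
      calc a.2 ≤ (a + b).2 := by simpa using hb2
        _ ≤ ‖(a + b).2‖ := le_abs_self _
        _ ≤ ‖a + b‖ := norm_snd_le _
    exact h1.trans (by gcongr)
  cocompact := by
    obtain ⟨hpres, -, -, K, hKΩ, hK, hcov⟩ := hdiv
    refine ⟨(fun x : Euc d => (x, (1 : ℝ))) '' K, ?_, hK.image (by fun_prop), ?_⟩
    · rintro _ ⟨x, hx, rfl⟩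
      exact mk_one_mem_coneOver.2 (hKΩ hx)
    · rintro _ ⟨t, ht, x, hx, rfl⟩
      rw [← hcov] at hx
      simp only [mem_iUnion] at hx
      obtain ⟨γ, hγ, y, hy, rfl⟩ := hx
      have hmem : ∀ p, γ p ∈ coneOver Ω ↔ p ∈ coneOver Ω := fun p => by
        conv_lhs => rw [← hpres γ hγ]
        exact γ.injective.mem_set_image
      set s : ℝ := (γ (y, 1)).2 with hs
      have hs0 : 0 < s := (mem_coneOver.1 ((hmem (y, 1)).2 (mk_one_mem_coneOver.2 (hKΩ hy)))).1
      have hγy : (projAct γ y, (1 : ℝ)) = s⁻¹ • γ (y, 1) := by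
        ext1
        · rfl
        · simp [← hs, inv_mul_cancel₀ hs0.ne']
      have hst : s / t ≠ 0 := (div_pos hs0 ht).ne'
      have hsmul : ∀ p : Euc d × ℝ, (s / t) • p ∈ coneOver Ω ↔ p ∈ coneOver Ω := fun p => by
        rw [mem_coneOver, mem_coneOver]
        have h0 := div_pos hs0 ht
        simp only [Prod.smul_snd, Prod.smul_fst, smul_eq_mul, mul_inv, smul_smul]
        rw [mul_pos_iff_of_pos_left h0, mul_right_comm, inv_mul_cancel₀ hst, one_mul]
      refine ⟨(γ.symm.trans (LinearEquiv.smulOfNeZero ℝ _ _ hst)).toContinuousLinearEquiv,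
        fun p => ?_, y, hy, ?_⟩
      · change (s / t) • γ.symm p ∈ _ ↔ _
        rw [hsmul, ← hmem, LinearEquiv.apply_symm_apply]
      · change (y, (1 : ℝ)) = (s / t) • γ.symm _
        rw [hγy, map_smul, map_smul, LinearEquiv.symm_apply_apply, smul_smul, smul_smul]
        have : s / t * t * s⁻¹ = 1 := by field_simp
        rw [this, one_smul]

theorem isIndecomposableCone_coneOver (hC : Convex ℝ (coneOver Ω))
    (hirr : IsIrreducibleDomain Ω) : IsIndecomposableCone (coneOver Ω) := by
  intro π hπ hsum
  by_contra! hne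
  set f : Euc d × ℝ →ₗ[ℝ] Euc d × ℝ := π.toLinearMap with hf
  have hker : ∀ x, x - π x ∈ LinearMap.ker f := fun x => by simp [hf, hπ]
  have hid : LinearMap.ker f ≠ ⊥ := fun h => hne.2 <| ContinuousLinearMap.ext fun x => by
    have := hker x
    rw [h, Submodule.mem_bot, sub_eq_zero] at this
    exact this.symm
  have hzero : LinearMap.range f ≠ ⊥ := fun h => hne.1 <| ContinuousLinearMap.ext fun x => by
    have : π x ∈ LinearMap.range f := ⟨x, rfl⟩
    rw [h, Submodule.mem_bot] at this
    exact this
  have hcompl : IsCompl (LinearMap.range f) (LinearMap.ker f) :=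
    LinearMap.IsIdempotentElem.isCompl (LinearMap.ext hπ)
  have hsmul : ∀ g : Euc d × ℝ →ₗ[ℝ] Euc d × ℝ, ∀ t : ℝ, 0 < t → ∀ c ∈ g '' coneOver Ω,
      t • c ∈ g '' coneOver Ω := by
    rintro g t ht _ ⟨_, ⟨u, hu, x, hx, rfl⟩, rfl⟩
    exact ⟨t • u • (x, 1), ⟨t * u, mul_pos ht hu, x, hx, smul_smul _ _ _⟩, map_smul _ _ _⟩
  let g : Euc d × ℝ →ₗ[ℝ] Euc d × ℝ := LinearMap.id - f
  refine hirr ⟨_, _, f '' coneOver Ω, g '' coneOver Ω, hzero, hid,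
    fun h => hid ?_, fun h => hzero ?_, hcompl, ?_, ?_, hC.linear_image f,
    hC.linear_image g, hsmul f, hsmul g, ?_⟩
  · simpa [h] using hcompl.inf_eq_bot
  · simpa [h] using hcompl.inf_eq_bot
  · rintro _ ⟨x, -, rfl⟩; exact ⟨x, rfl⟩
  · rintro _ ⟨x, -, rfl⟩; exact hker x
  · ext p
    constructor
    · intro hp
      exact ⟨f p, ⟨p, hp, rfl⟩, p - f p, ⟨p, hp, rfl⟩, by abel⟩
    · rintro ⟨_, ⟨x, hx, rfl⟩, _, ⟨y, hy, rfl⟩, rfl⟩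
      exact hsum x hx y hy

end ConeOver

theorem mem_convexHull_range {E ι : Type*} [AddCommGroup E] [Module ℝ E] [Fintype ι]
    {v : ι → E} {x : E} :
    x ∈ convexHull ℝ (range v) ↔ ∃ t : ι → ℝ, (∀ i, 0 ≤ t i) ∧ ∑ i, t i = 1 ∧
      ∑ i, t i • v i = x := by
  classical
  constructor
  · intro hx
    have h : convexHull ℝ (range v) ⊆ (fun t : ι → ℝ => ∑ i, t i • v i) '' stdSimplex ℝ ι := by
      refine convexHull_min ?_ ?_
      · rintro _ ⟨i, rfl⟩
        exact ⟨Pi.single i 1, single_mem_stdSimplex ℝ i, by simp [Pi.single_apply]⟩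
      · exact (convex_stdSimplex ℝ ι).linear_image (Fintype.linearCombination ℝ v)
    obtain ⟨t, ht, hx⟩ := h hx
    exact ⟨t, ht.1, ht.2, hx⟩
  · rintro ⟨t, ht, h1, hx⟩
    exact mem_convexHull_of_exists_fintype t v ht h1 (fun i => ⟨i, rfl⟩) hx

/-- The centroid of a facet of a simplex is not an intrinsically interior point. -/
theorem sum_erase_notMem_intrinsicInterior {E ι : Type*} [NormedAddCommGroup E] [NormedSpace ℝ E]
    [Fintype ι] [DecidableEq ι] {v : ι → E} (hv : AffineIndependent ℝ v) {j : ι} {t : ℝ}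
    (ht : ∑ _i ∈ Finset.univ.erase j, t = 1) :
    ∑ i ∈ Finset.univ.erase j, t • v i ∉ intrinsicInterior ℝ (convexHull ℝ (range v)) := by
  intro hb
  set b : E := ∑ i ∈ Finset.univ.erase j, t • v i with hbdef
  obtain ⟨y, hy, hyb⟩ := mem_intrinsicInterior.1 hb
  have hvj : v j ∈ affineSpan ℝ (convexHull ℝ (range v)) :=
    subset_affineSpan ℝ _ (subset_convexHull ℝ _ ⟨j, rfl⟩)
  have hbs : b ∈ affineSpan ℝ (convexHull ℝ (range v)) := hyb ▸ y.2
  let c : ℝ → affineSpan ℝ (convexHull ℝ (range v)) := fun s =>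
    ⟨AffineMap.lineMap (v j) b s, AffineMap.lineMap_mem s hvj hbs⟩
  have hc : Continuous c := AffineMap.lineMap_continuous.subtype_mk _
  have hc1 : c 1 = y := Subtype.ext (by simp [c, hyb])
  have hev : ∀ᶠ s in nhds (1 : ℝ), AffineMap.lineMap (v j) b s ∈ convexHull ℝ (range v) := by
    have := hc.continuousAt.preimage_mem_nhds (hc1 ▸ mem_interior_iff_mem_nhds.1 hy)
    exact this
  obtain ⟨s, hs1, hs⟩ := (frequently_gt_nhds (1 : ℝ)).and_eventually hev |>.exists
  obtain ⟨r, hr0, hr1, hrs⟩ := mem_convexHull_range.1 hs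
  let q : ι → ℝ := fun i => if i = j then 1 - s else s * t
  have hqj : q j = 1 - s := if_pos rfl
  have hq : ∀ i ∈ Finset.univ.erase j, q i = s * t := fun i hi =>
    if_neg (Finset.ne_of_mem_erase hi)
  have h0 := affineIndependent_iff.1 hv Finset.univ (fun i => r i - q i) ?_ ?_ j (Finset.mem_univ j)
  · have := hr0 j
    rw [hqj] at h0
    linarith
  · rw [Finset.sum_sub_distrib, hr1, ← Finset.add_sum_erase _ _ (Finset.mem_univ j), hqj,
      Finset.sum_congr rfl hq, ← Finset.mul_sum, ht]
    ring
  · simp only [sub_smul]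
    rw [Finset.sum_sub_distrib, hrs, ← Finset.add_sum_erase _ _ (Finset.mem_univ j), hqj,
      Finset.sum_congr rfl fun i hi => congrArg (· • v i) (hq i hi),
      AffineMap.lineMap_apply_module, hbdef]
    simp only [mul_smul, Finset.smul_sum, sub_self]

namespace IsFlatWith

variable {d : ℕ} {Ω : Set (Euc d)} {v : Fin d → Euc d}

theorem nonempty (hd : 0 < d) :
    (intrinsicInterior ℝ (convexHull ℝ (range v))).Nonempty :=
  Set.Nonempty.intrinsicInterior (convex_convexHull ℝ _)
    (convexHull_nonempty_iff.2 ⟨v ⟨0, hd⟩, _, rfl⟩)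

theorem exists_frame (hd : 2 ≤ d) (hC : IsQuasiHomogeneousCone (coneOver Ω))
    (hv : IsFlatWith Ω v) :
    ∃ φ : Fin d → Euc d × ℝ →L[ℝ] ℝ, IsFrame (coneOver Ω) (fun i => (v i, (1 : ℝ))) φ := by
  obtain ⟨hind, hbdry, hint, hfac⟩ := hv
  have hcl : ∀ i, (v i, (1 : ℝ)) ∈ closure (coneOver Ω) := fun i =>
    mk_one_mem_closure_coneOver (hbdry i).1
  obtain ⟨y, hy⟩ := nonempty (v := v) (by omega)
  have hyC := mk_one_mem_coneOver.2 (hint hy)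
  obtain ⟨t, ht0, ht1, hty⟩ := mem_convexHull_range.1 (intrinsicInterior_subset hy)
  have ht : ∀ i, t i ≤ 1 := fun i => ht1 ▸ Finset.single_le_sum (fun k _ => ht0 k)
    (Finset.mem_univ i)
  refine IsFrame.exists_of_facet_notMem hC hcl ?_ fun j hj => ?_
  · have h := hC.add_mem_of_mem_closure hyC (hC.sum_smul_mem_closure ⟨_, hyC⟩ Finset.univ
      (t := fun i => 1 - t i) (x := fun i => (v i, (1 : ℝ)))
      (fun i _ => sub_nonneg.2 (ht i)) fun i _ => hcl i)
    convert h using 1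
    have : (y, (1 : ℝ)) = ∑ i, t i • (v i, (1 : ℝ)) := by
      ext1 <;> simp [Prod.fst_sum, Prod.snd_sum, hty, ht1]
    rw [this, ← Finset.sum_add_distrib]
    refine Finset.sum_congr rfl fun i _ => ?_
    rw [← add_smul, add_sub_cancel, one_smul]
  · have hd1 : (0 : ℝ) < (d : ℝ) - 1 := by
      have : (2 : ℝ) ≤ d := by exact_mod_cast hd
      linarith
    have hcard : ((Finset.univ.erase j).card : ℝ) = (d : ℝ) - 1 := by
      rw [Finset.card_erase_of_mem (Finset.mem_univ j), Finset.card_univ, Fintype.card_fin,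
        Nat.cast_sub (by omega), Nat.cast_one]
    have hsum : ∑ _i ∈ Finset.univ.erase j, ((d : ℝ) - 1)⁻¹ = 1 := by
      rw [Finset.sum_const, nsmul_eq_mul, hcard, mul_inv_cancel₀ hd1.ne']
    have hb : ∑ i ∈ Finset.univ.erase j, ((d : ℝ) - 1)⁻¹ • v i ∈ convexHull ℝ (range v) :=
      (convex_convexHull ℝ _).sum_mem (fun _ _ => by positivity) hsum
        fun i _ => subset_convexHull ℝ _ ⟨i, rfl⟩
    refine (hfac ⟨hb, sum_erase_notMem_intrinsicInterior hind hsum⟩).2 ?_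
    have := (mem_coneOver.1 hj).2
    simpa [Prod.fst_sum, Prod.snd_sum, hcard, ← Finset.smul_sum] using this

/-- A flat is the intersection of the domain with the hyperplane it spans. -/
theorem eq_setOf (hC : IsQuasiHomogeneousCone (coneOver Ω)) (hv : IsFlatWith Ω v)
    {φ : Fin d → Euc d × ℝ →L[ℝ] ℝ} (hF : IsFrame (coneOver Ω) (fun i => (v i, (1 : ℝ))) φ)
    {σ : Euc d × ℝ →L[ℝ] ℝ} (hσ : σ ≠ 0) (hσv : ∀ i, σ (v i, 1) = 0) :
    intrinsicInterior ℝ (convexHull ℝ (range v)) = {x ∈ Ω | σ (x, 1) = 0} := by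
  ext x
  constructor
  · intro hx
    refine ⟨hv.2.2.1 hx, ?_⟩
    obtain ⟨t, -, ht1, rfl⟩ := mem_convexHull_range.1 (intrinsicInterior_subset hx)
    have : (∑ i, t i • v i, (1 : ℝ)) = ∑ i, t i • (v i, (1 : ℝ)) := by
      ext1 <;> simp [Prod.fst_sum, Prod.snd_sum, ht1]
    rw [this, map_sum]
    simp only [map_smul, hσv, smul_zero, Finset.sum_const_zero]
  · rintro ⟨hxΩ, hx⟩
    have h := hF.eq_sum_of_apply_eq_zero (by simp) hσ hσv hx
    have hmem : x ∈ convexHull ℝ (range v) := by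
      refine mem_convexHull_range.2 ⟨fun i => φ i (x, 1),
        fun i => (hF.pos hC i (mk_one_mem_coneOver.2 hxΩ)).le, ?_, ?_⟩
      · simpa [Prod.snd_sum] using (congrArg Prod.snd h).symm
      · simpa [Prod.fst_sum] using (congrArg Prod.fst h).symm
    by_contra hx'
    exact (hv.2.2.2 ⟨hmem, hx'⟩).2 hxΩ

/-- The vertices of a flat are in its closure. -/
theorem vertex_mem_closure (hd : 0 < d) (hop : IsOpen Ω) (hconv : Convex ℝ Ω)
    (hC : IsQuasiHomogeneousCone (coneOver Ω)) (hv : IsFlatWith Ω v)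
    {φ : Fin d → Euc d × ℝ →L[ℝ] ℝ} (hF : IsFrame (coneOver Ω) (fun i => (v i, (1 : ℝ))) φ)
    {σ : Euc d × ℝ →L[ℝ] ℝ} (hσ : σ ≠ 0) (hσv : ∀ i, σ (v i, 1) = 0) (i : Fin d) :
    v i ∈ closure (intrinsicInterior ℝ (convexHull ℝ (range v))) := by
  have heq := hv.eq_setOf hC hF hσ hσv
  obtain ⟨b, hb⟩ := nonempty (v := v) hd
  have hseg : openSegment ℝ b (v i) ⊆ intrinsicInterior ℝ (convexHull ℝ (range v)) := by
    rw [heq] at hb ⊢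
    intro x hx
    refine ⟨?_, ?_⟩
    · have := hconv.openSegment_interior_closure_subset_interior
        (by rw [hop.interior_eq]; exact hb.1) (hv.2.1 i).1 hx
      rwa [hop.interior_eq] at this
    · obtain ⟨r, s, -, -, hrs, rfl⟩ := hx
      have : (r • b + s • v i, (1 : ℝ)) = r • (b, (1 : ℝ)) + s • (v i, (1 : ℝ)) := by
        ext1 <;> simp [hrs]
      rw [this, map_add, map_smul, map_smul, hb.2, hσv]
      simp
  refine closure_mono hseg ?_
  rw [closure_openSegment]
  exact right_mem_segment ℝ _ _

end IsFlatWith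

/-- A flat spanned by a hyperplane close to another flat coincides with it. -/
theorem IsFlat.exists_pos_forall_eq {d : ℕ} {Ω : Set (Euc d)} (hd : 3 ≤ d)
    (hbd : Bornology.IsBounded Ω) (hop : IsOpen Ω) (hconv : Convex ℝ Ω)
    (hC : IsQuasiHomogeneousCone (coneOver Ω)) (hI : IsIndecomposableCone (coneOver Ω))
    {F : Set (Euc d)} (hF : IsFlat Ω F) :
    ∃ η > 0, ∀ F', IsFlat Ω F' → hausdorffDist (closure F') (closure F) < η → F' = F := by
  obtain ⟨v, hv, rfl⟩ := hF
  obtain ⟨φ, hφ⟩ := hv.exists_frame (by omega) hC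
  have hcard : Fintype.card (Fin d) + 1 = Module.finrank ℝ (Euc d × ℝ) := by simp
  obtain ⟨η, hη, H⟩ := hφ.exists_pos_forall_apply_eq_zero hcard
    (by simpa using Nat.lt_of_succ_le hd) hC hI
  have hspan : ∀ {w : Fin d → Euc d} {ψ : Fin d → Euc d × ℝ →L[ℝ] ℝ},
      IsFrame (coneOver Ω) (fun i => (w i, (1 : ℝ))) ψ →
      ∃ σ : Euc d × ℝ →L[ℝ] ℝ, σ ≠ 0 ∧ ∀ i, σ (w i, 1) = 0 := fun hψ => by
    obtain ⟨e, he, hψe⟩ := IsFrame.exists_transversal _ hcard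
    obtain ⟨σ, -, hσe, hσ⟩ := hψ.exists_coordinate hcard he hψe
    exact ⟨σ, fun h => by simp [h] at hσe, hσ⟩
  refine ⟨η, hη, ?_⟩
  rintro _ ⟨w, hw, rfl⟩ hdist
  obtain ⟨ψ, hψ⟩ := hw.exists_frame (by omega) hC
  obtain ⟨τ, hτ0, hτ⟩ := hspan hφ
  obtain ⟨σ, hσ0, hσ⟩ := hspan hψ
  have heq := hw.eq_setOf hC hψ hσ0 hσ
  have hfin : hausdorffEDist (closure (intrinsicInterior ℝ (convexHull ℝ (range w))))
      (closure (intrinsicInterior ℝ (convexHull ℝ (range v)))) ≠ ⊤ :=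
    hausdorffEDist_ne_top_of_nonempty_of_bounded
      (IsFlatWith.nonempty (by omega)).closure (IsFlatWith.nonempty (by omega)).closure
      (hbd.subset hw.2.2.1).closure (hbd.subset hv.2.2.1).closure
  have hnear : ∀ i, ∃ y, σ (y, 1) = 0 ∧ dist y (v i) < η := fun i => by
    obtain ⟨y, hy, hyv⟩ := exists_dist_lt_of_hausdorffDist_lt'
      (hv.vertex_mem_closure (by omega) hop hconv hC hφ hτ0 hτ i) hdist hfin
    refine ⟨y, ?_, hyv⟩
    have hcl : IsClosed {x : Euc d | σ (x, 1) = 0} :=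
      isClosed_eq (by fun_prop) continuous_const
    refine closure_minimal ?_ hcl hy
    rw [heq]
    exact fun x hx => hx.2
  choose y hy0 hyv using hnear
  have hσv := H _ ψ σ hψ hσ0 hσ (fun i => (y i, 1)) hy0 fun i => by
    simpa [Prod.norm_def, ← dist_eq_norm, dist_comm] using (hyv i).le
  rw [heq, hv.eq_setOf hC hφ hσ0 hσv]

theorem boundary_flats_closed_discrete {d : ℕ} (Ω : Set (Euc d)) (hne : Ω.Nonempty)
    (hbd : Bornology.IsBounded Ω) (hop : IsOpen Ω) (hconv : Convex ℝ Ω)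
    (hd : 3 ≤ d) (hirr : IsIrreducibleDomain Ω)
    (Γ : Subgroup ((Euc d × ℝ) ≃ₗ[ℝ] (Euc d × ℝ)))
    (htf : TorsionFreeSub Γ) (hdiv : Divides Ω Γ)
    :
    ¬ ∃ (Fs : ℕ → Set (Euc d)) (F : Set (Euc d)),
        (∀ i, IsBoundaryFlat Ω (Fs i)) ∧ (∀ i j, i ≠ j → Fs i ≠ Fs j) ∧
        IsFlat Ω F ∧ FlatsConverge Fs F := by
  rintro ⟨Fs, F, hFs, hinj, hF, hconv'⟩
  have hC := isQuasiHomogeneousCone_coneOver hbd hop hconv hdiv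
  obtain ⟨η, hη, H⟩ := hF.exists_pos_forall_eq hd hbd hop hconv hC
    (isIndecomposableCone_coneOver hC.convex hirr)
  obtain ⟨N, hN⟩ := eventually_atTop.1 (Tendsto.eventually_lt_const hη hconv')
  exact hinj N (N + 1) (Nat.succ_ne_self N).symm
    ((H _ (hFs N).1 (hN N le_rfl)).trans (H _ (hFs (N + 1)).1 (hN (N + 1) (Nat.le_succ N))).symm)
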